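/- Let Ω•(A) be a complete calculus on a quantum principal bundle B = A^{coH} ⊆ A. Then: (i) there is a surjective morphism of DGAs π_v: Ω•(A)→ver• extending id_A, determined in degree k by π_v = (id⊗(π_{Λ•}∘π^k))∘Δ_A•|_{Ω^k(A)} and given explicitly by π_v(a⁰ da¹∧…∧daᵏ) = a⁰₀a¹₀…aᵏ₀⊗S(a⁰₁a¹₁…aᵏ₁)a⁰₂ da¹₂∧…∧daᵏ₂; (ii) the vertical forms ver• are complete, i.e. Δ_A extends to a morphism of DGAs Δ_v•: ver•→ver•⊗Ω•(H), and the diagram commutes: Δ_v•∘π_v = (π_v⊗id)∘Δ_A•. -/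

import Mathlib

open TensorProduct

noncomputable section

namespace NCG

variable {k : Type*} [CommRing k]

/-! ## Coactions -/

section Coactions

variable {H : Type*} [AddCommMonoid H] [Module k H] [Coalgebra k H]
variable {M : Type*} [AddCommMonoid M] [Module k M]

/-- `ρ : M → M ⊗ H` is a (counital, coassociative) right `H`-coaction. -/
def IsRightCoaction (ρ : M →ₗ[k] M ⊗[k] H) : Prop :=
  (LinearMap.lTensor M (Coalgebra.counit (R := k) (A := H)) ∘ₗ ρ
      = (TensorProduct.mk k M k).flip 1) ∧
  ((TensorProduct.assoc k M H H).toLinearMap ∘ₗ LinearMap.rTensor H ρ ∘ₗ ρ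
      = LinearMap.lTensor M (Coalgebra.comul (R := k) (A := H)) ∘ₗ ρ)

/-- `lam : M → H ⊗ M` is a left `H`-coaction. -/
def IsLeftCoaction (lam : M →ₗ[k] H ⊗[k] M) : Prop :=
  (LinearMap.rTensor M (Coalgebra.counit (R := k) (A := H)) ∘ₗ lam
      = TensorProduct.mk k k M 1) ∧
  ((TensorProduct.assoc k H H M).symm.toLinearMap ∘ₗ LinearMap.lTensor H lam ∘ₗ lam
      = LinearMap.rTensor M (Coalgebra.comul (R := k) (A := H)) ∘ₗ lam)

end Coactions

/-! ## Comodule algebras, coinvariants, Hopf–Galois extensions -/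

section ComodAlg

variable (k) in
/-- A right `H`-comodule algebra structure on `A`: an algebra morphism
`ρ : A → A ⊗ H` which is a right `H`-coaction. -/
structure ComodAlg (H : Type*) [Ring H] [Bialgebra k H]
    (A : Type*) [Ring A] [Algebra k A] where
  ρ : A →ₐ[k] A ⊗[k] H
  coaction : IsRightCoaction (k := k) ρ.toLinearMap

variable {H : Type*} [Ring H] [Bialgebra k H]
variable {A : Type*} [Ring A] [Algebra k A]

/-- The coinvariant subalgebra `B = A^{co H}` (as a submodule). -/
def ComodAlg.coinv (S : ComodAlg k H A) : Submodule k A where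
  carrier := {a | S.ρ a = a ⊗ₜ[k] (1 : H)}
  add_mem' := by
    intro a b ha hb
    simp only [Set.mem_setOf_eq] at *
    rw [map_add, ha, hb, TensorProduct.add_tmul]
  zero_mem' := by simp
  smul_mem' := by
    intro c a ha
    simp only [Set.mem_setOf_eq] at *
    rw [map_smul, ha, TensorProduct.smul_tmul']

lemma ComodAlg.one_mem_coinv (S : ComodAlg k H A) : (1 : A) ∈ S.coinv := by
  show S.ρ 1 = _
  rw [map_one, Algebra.TensorProduct.one_def]

/-- The lift `χ' : A ⊗ A → A ⊗ H`, `a ⊗ a' ↦ (a ⊗ 1) · ρ(a') = a a'₍₀₎ ⊗ a'₍₁₎`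
of the canonical Hopf–Galois map. -/
def chiAux (S : ComodAlg k H A) : A ⊗[k] A →ₗ[k] A ⊗[k] H :=
  TensorProduct.lift
    ((LinearMap.mul k (A ⊗[k] H) ∘ₗ (TensorProduct.mk k A H).flip 1).compl₂ S.ρ.toLinearMap)

/-- The relations defining the balanced tensor product `A ⊗_B A` over a
subalgebra (submodule) `B ⊆ A`. -/
def balRel (B : Submodule k A) : Submodule k (A ⊗[k] A) :=
  Submodule.span k
    {x | ∃ (a a' : A) (b : B), x = (a * (b : A)) ⊗ₜ[k] a' - a ⊗ₜ[k] ((b : A) * a')}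

/-- The balanced tensor product `A ⊗_B A`. -/
abbrev TensorOver (B : Submodule k A) : Type _ := (A ⊗[k] A) ⧸ balRel B

/-- `B = A^{co H} ⊆ A` is a Hopf–Galois extension:  the canonical map
`χ : A ⊗_B A → A ⊗ H` is bijective, i.e. its lift `χ'` is surjective with
kernel exactly the balanced relations. -/
def ComodAlg.IsHopfGalois (S : ComodAlg k H A) : Prop :=
  Function.Surjective (chiAux S) ∧ LinearMap.ker (chiAux S) = balRel S.coinv

/-- The canonical Hopf–Galois map `χ : A ⊗_B A → A ⊗ H` on the balanced
tensor product. -/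
def chiQ (S : ComodAlg k H A) (h : balRel S.coinv ≤ LinearMap.ker (chiAux S)) :
    TensorOver S.coinv →ₗ[k] A ⊗[k] H :=
  Submodule.liftQ _ (chiAux S) h

end ComodAlg

section HopfGalois

variable {H : Type*} [Ring H] [HopfAlgebra k H]
variable {A : Type*} [Ring A] [Algebra k A]

/-- A strong connection (in the sense of Theorem 3.7): a linear map
`ℓ : H → A ⊗ A` satisfying the four identities characterising faithfully
flat Hopf–Galois extensions (principal comodule algebras). -/
def IsStrongConnection (S : ComodAlg k H A) (ℓ : H →ₗ[k] A ⊗[k] A) : Prop :=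
  ℓ 1 = 1 ⊗ₜ[k] 1 ∧
  chiAux S ∘ₗ ℓ = TensorProduct.mk k A H 1 ∧
  LinearMap.mul' k A ∘ₗ ℓ =
    Algebra.linearMap k A ∘ₗ Coalgebra.counit (R := k) (A := H) ∧
  LinearMap.lTensor A S.ρ.toLinearMap ∘ₗ ℓ =
    (TensorProduct.assoc k A A H).toLinearMap ∘ₗ LinearMap.rTensor H ℓ ∘ₗ
      Coalgebra.comul (R := k) (A := H) ∧
  LinearMap.rTensor A S.ρ.toLinearMap ∘ₗ ℓ =
    LinearMap.rTensor A (TensorProduct.comm k H A).toLinearMap ∘ₗ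
      (TensorProduct.assoc k H A A).symm.toLinearMap ∘ₗ
      TensorProduct.map (HopfAlgebra.antipode (R := k)) ℓ ∘ₗ
      Coalgebra.comul (R := k) (A := H)

/-- A quantum principal bundle: a faithfully flat Hopf–Galois extension
`B = A^{co H} ⊆ A`, encoded (following Theorem 3.7 = Th. 6.19/6.20 of
Brzeziński–Wisbauer/Hajac et al.) as a Hopf–Galois extension admitting a
strong connection. -/
def ComodAlg.IsQPB (S : ComodAlg k H A) : Prop :=
  S.IsHopfGalois ∧ ∃ ℓ : H →ₗ[k] A ⊗[k] A, IsStrongConnection S ℓ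

end HopfGalois

/-! ## Differential graded algebras and differential calculi -/

section DGA

variable (k) in
/-- A differential graded algebra: an `ℕ`-graded algebra `Ω` together with a
degree `1` differential squaring to zero and satisfying the graded Leibniz
rule. -/
structure DGA (Ω : Type*) [Ring Ω] [Algebra k Ω] where
  grading : ℕ → Submodule k Ω
  gradedAlgebra : GradedAlgebra grading
  d : Ω →ₗ[k] Ω
  d_mem : ∀ n, ∀ x ∈ grading n, d x ∈ grading (n + 1)
  d_d : ∀ x, d (d x) = 0
  leibniz : ∀ n, ∀ ω ∈ grading n, ∀ η,
    d (ω * η) = d ω * η + ((-1 : k) ^ n) • (ω * d η)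

variable {Ω : Type*} [Ring Ω] [Algebra k Ω]

/-- Projection onto the degree `n` component of a graded algebra. -/
def DGA.projN (C : DGA k Ω) (n : ℕ) : Ω →ₗ[k] Ω :=
  letI := C.gradedAlgebra
  (C.grading n).subtype ∘ₗ DirectSum.component k ℕ (fun i => ↥(C.grading i)) n ∘ₗ
    (DirectSum.decomposeLinearEquiv C.grading).toLinearMap

/-- The sign operator `ς` of a graded algebra, acting by `(-1)^n` in degree `n`. -/
def DGA.sign (C : DGA k Ω) : Ω →ₗ[k] Ω :=
  letI := C.gradedAlgebra
  (DirectSum.toModule k ℕ Ω fun n => ((-1 : k) ^ n) • (C.grading n).subtype) ∘ₗ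
    (DirectSum.decomposeLinearEquiv C.grading).toLinearMap

variable {Ξ : Type*} [Ring Ξ] [Algebra k Ξ]
variable {M : Type*} [AddCommGroup M] [Module k M]

/-- The graded (Koszul) braiding `Ξ ⊗ M → M ⊗ Ξ`, `θ ⊗ m ↦ (-1)^{|θ||m|} m ⊗ θ`,
where the sign on `M` is implemented by the sign operator `s`. -/
def gradedBraid (CN : DGA k Ξ) (s : M →ₗ[k] M) : Ξ ⊗[k] M →ₗ[k] M ⊗[k] Ξ :=
  letI := CN.gradedAlgebra
  TensorProduct.lift
    ((DirectSum.toModule k ℕ (M →ₗ[k] M ⊗[k] Ξ) fun j =>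
        (LinearMap.llcomp k M M (M ⊗[k] Ξ)).flip (s ^ j) ∘ₗ
          (TensorProduct.mk k M Ξ).flip ∘ₗ (CN.grading j).subtype) ∘ₗ
      (DirectSum.decomposeLinearEquiv CN.grading).toLinearMap)

/-- The multiplication of the graded (Koszul-signed) tensor product
`(m ⊗ θ)(m' ⊗ θ') = (-1)^{|θ||m'|} m m' ⊗ θ θ'`, for a (possibly non-unital
carrier) `M` with multiplication `mulM` and sign operator `sM`, and a graded
algebra `Ξ`. -/
def koszulMulGen (mulM : M ⊗[k] M →ₗ[k] M) (mulN : Ξ ⊗[k] Ξ →ₗ[k] Ξ)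
    (CN : DGA k Ξ) (sM : M →ₗ[k] M) :
    (M ⊗[k] Ξ) ⊗[k] (M ⊗[k] Ξ) →ₗ[k] M ⊗[k] Ξ :=
  TensorProduct.map mulM mulN ∘ₗ
    (TensorProduct.assoc k (M ⊗[k] M) Ξ Ξ).toLinearMap ∘ₗ
    LinearMap.rTensor Ξ
      ((TensorProduct.assoc k M M Ξ).symm.toLinearMap ∘ₗ
        LinearMap.lTensor M (gradedBraid CN sM) ∘ₗ
        (TensorProduct.assoc k M Ξ M).toLinearMap) ∘ₗ
    (TensorProduct.assoc k (M ⊗[k] Ξ) M Ξ).symm.toLinearMap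

/-- The Koszul multiplication on the tensor product of two graded algebras. -/
def koszulMul (CM : DGA k Ω) (CN : DGA k Ξ) :
    (Ω ⊗[k] Ξ) ⊗[k] (Ω ⊗[k] Ξ) →ₗ[k] Ω ⊗[k] Ξ :=
  koszulMulGen (LinearMap.mul' k Ω) (LinearMap.mul' k Ξ) CN CM.sign

/-- The tensor product differential `d_⊗ = d ⊗ 1 + ς ⊗ d'`. -/
def dTensorGen (dM : M →ₗ[k] M) (sM : M →ₗ[k] M) {N : Type*} [AddCommGroup N]
    [Module k N] (dN : N →ₗ[k] N) : M ⊗[k] N →ₗ[k] M ⊗[k] N :=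
  TensorProduct.map dM LinearMap.id + TensorProduct.map sM dN

/-- The grading of the tensor product of two graded modules. -/
def tensorGrading {N : Type*} [AddCommGroup N] [Module k N]
    (𝒜 : ℕ → Submodule k M) (ℬ : ℕ → Submodule k N) (n : ℕ) :
    Submodule k (M ⊗[k] N) :=
  ⨆ p : {p : ℕ × ℕ // p.1 + p.2 = n},
    LinearMap.range (TensorProduct.map (𝒜 p.1.1).subtype (ℬ p.1.2).subtype)

end DGA

section DiffCalc

variable (k) in
/-- A differential calculus on an algebra `A`: a differential graded algebra
`Ω` with degree-zero part `A` (embedded via `ι`), generated in degree zero. -/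
structure DiffCalc (A : Type*) [Ring A] [Algebra k A]
    (Ω : Type*) [Ring Ω] [Algebra k Ω] extends DGA k Ω where
  ι : A →ₐ[k] Ω
  ι_injective : Function.Injective ι
  range_ι : ∀ x, x ∈ grading 0 ↔ x ∈ Set.range ι
  generated : Algebra.adjoin k (Set.range ι ∪ ⇑d '' Set.range ι) = ⊤

variable {A : Type*} [Ring A] [Algebra k A]
variable {Ω : Type*} [Ring Ω] [Algebra k Ω]

lemma DiffCalc.ι_mem (C : DiffCalc k A Ω) (a : A) : C.ι a ∈ C.grading 0 :=
  (C.range_ι _).2 ⟨a, rfl⟩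

lemma DiffCalc.d_ι_mem (C : DiffCalc k A Ω) (a : A) : C.d (C.ι a) ∈ C.grading 1 := by
  simpa using C.d_mem 0 (C.ι a) (C.ι_mem a)

lemma DiffCalc.sandwich_mem (C : DiffCalc k A Ω) (a b : A) {x : Ω}
    (hx : x ∈ C.grading 1) : C.ι a * x * C.ι b ∈ C.grading 1 := by
  letI := C.gradedAlgebra
  have h1 : C.ι a * x ∈ C.grading (0 + 1) := SetLike.mul_mem_graded (C.ι_mem a) hx
  have h2 : C.ι a * x * C.ι b ∈ C.grading (0 + 1 + 0) :=
    SetLike.mul_mem_graded h1 (C.ι_mem b)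
  simpa using h2

/-- The degree-zero identification `A ≃ Ω⁰`. -/
def DiffCalc.iota0 (C : DiffCalc k A Ω) : A ≃ₗ[k] ↥(C.grading 0) :=
  LinearEquiv.ofBijective (LinearMap.codRestrict (C.grading 0) C.ι.toLinearMap C.ι_mem)
    ⟨fun a b hab => C.ι_injective (congrArg Subtype.val hab),
     fun y => by
      obtain ⟨a, ha⟩ := (C.range_ι ↑y).1 y.2
      exact ⟨a, Subtype.ext ha⟩⟩

/-- Projection `Ω → A` onto the degree-zero component. -/
def DiffCalc.proj0 (C : DiffCalc k A Ω) : Ω →ₗ[k] A :=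
  letI := C.gradedAlgebra
  C.iota0.symm.toLinearMap ∘ₗ DirectSum.component k ℕ (fun i => ↥(C.grading i)) 0 ∘ₗ
    (DirectSum.decomposeLinearEquiv C.grading).toLinearMap

end DiffCalc

/-! ## Covariant calculi -/

section Covariant

variable {H : Type*} [Ring H] [Bialgebra k H]
variable {A : Type*} [Ring A] [Algebra k A]
variable {Ω : Type*} [Ring Ω] [Algebra k Ω]

/-- The comultiplication of a bialgebra, as a comodule-algebra structure of
`H` over itself. -/
def comulComod (k : Type*) [CommRing k] (H : Type*) [Ring H] [Bialgebra k H] :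
    ComodAlg k H H where
  ρ := Bialgebra.comulAlgHom k H
  coaction := by
    constructor
    · exact Coalgebra.lTensor_counit_comp_comul
    · exact Coalgebra.coassoc

/-- A right `H`-covariant differential calculus on a comodule algebra `A`:
the coaction `ΔR` extends `ρ` multiplicatively, degree-wise, and commutes
with the differential. -/
def IsRightCovariant (S : ComodAlg k H A) (C : DiffCalc k A Ω)
    (ΔR : Ω →ₗ[k] Ω ⊗[k] H) : Prop :=
  IsRightCoaction (k := k) ΔR ∧
  ΔR 1 = 1 ∧ (∀ x y, ΔR (x * y) = ΔR x * ΔR y) ∧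
  (∀ n, ∀ x ∈ C.grading n,
    ΔR x ∈ LinearMap.range (LinearMap.rTensor H (C.grading n).subtype)) ∧
  ΔR ∘ₗ C.d = LinearMap.rTensor H C.d ∘ₗ ΔR ∧
  ΔR ∘ₗ C.ι.toLinearMap = LinearMap.rTensor H C.ι.toLinearMap ∘ₗ S.ρ.toLinearMap

/-- A left-covariant differential calculus on the Hopf algebra `H` itself:
the left coaction `ΛL` extends the comultiplication. -/
def IsLeftCovariantH (C : DiffCalc k H Ω) (ΛL : Ω →ₗ[k] H ⊗[k] Ω) : Prop :=
  IsLeftCoaction (k := k) ΛL ∧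
  ΛL 1 = 1 ∧ (∀ x y, ΛL (x * y) = ΛL x * ΛL y) ∧
  (∀ n, ∀ x ∈ C.grading n,
    ΛL x ∈ LinearMap.range (LinearMap.lTensor H (C.grading n).subtype)) ∧
  ΛL ∘ₗ C.d = LinearMap.lTensor H C.d ∘ₗ ΛL ∧
  ΛL ∘ₗ C.ι.toLinearMap =
    LinearMap.lTensor H C.ι.toLinearMap ∘ₗ Coalgebra.comul (R := k) (A := H)

/-- A bicovariant differential calculus on `H`: commuting right and left
covariant structures both extending the comultiplication. -/
def IsBicovariantH (C : DiffCalc k H Ω) (ΔR : Ω →ₗ[k] Ω ⊗[k] H)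
    (ΛL : Ω →ₗ[k] H ⊗[k] Ω) : Prop :=
  IsRightCovariant (comulComod k H) C ΔR ∧ IsLeftCovariantH C ΛL ∧
  LinearMap.rTensor H ΛL ∘ₗ ΔR =
    (TensorProduct.assoc k H Ω H).symm.toLinearMap ∘ₗ LinearMap.lTensor H ΔR ∘ₗ ΛL

/-- Left-coinvariant elements of a left comodule. -/
def leftCoinv {M : Type*} [AddCommGroup M] [Module k M]
    (lam : M →ₗ[k] H ⊗[k] M) : Submodule k M where
  carrier := {m | lam m = 1 ⊗ₜ[k] m}
  add_mem' := by
    intro a b ha hb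
    simp only [Set.mem_setOf_eq] at *
    rw [map_add, ha, hb, TensorProduct.tmul_add]
  zero_mem' := by simp
  smul_mem' := by
    intro c m hm
    simp only [Set.mem_setOf_eq] at *
    rw [map_smul, hm, TensorProduct.tmul_smul]

end Covariant

/-! ## Maximal prolongations -/

section MaxProl

universe u

variable {A : Type*} [Ring A] [Algebra k A]
variable {Ω : Type*} [Ring Ω] [Algebra k Ω]

/-- `g` identifies the first-order parts of the differential calculi `C` and
`C'` (as first order differential calculi over `A`). -/
def Matches1 {Ω' : Type*} [Ring Ω'] [Algebra k Ω'] (C : DiffCalc k A Ω)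
    (C' : DiffCalc k A Ω') (g : ↥(C.grading 1) →ₗ[k] Ω') : Prop :=
  (∀ x : C.grading 1, g x ∈ C'.grading 1) ∧
  Function.Injective g ∧
  (∀ y ∈ C'.grading 1, ∃ x, g x = y) ∧
  (∀ a : A, g ⟨C.d (C.ι a), C.d_ι_mem a⟩ = C'.d (C'.ι a)) ∧
  (∀ (a b : A) (x : C.grading 1),
    g ⟨C.ι a * ↑x * C.ι b, C.sandwich_mem a b x.2⟩ = C'.ι a * g x * C'.ι b)

/-- `C` is the maximal prolongation of its own first-order part: any other
differential calculus on `A` with the same first order is a quotient of `C`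
(universal property of the maximal prolongation). -/
def IsMaxProl (C : DiffCalc k A Ω) : Prop :=
  ∀ (Ω' : Type u) [Ring Ω'] [Algebra k Ω'], ∀ (C' : DiffCalc k A Ω')
    (g : ↥(C.grading 1) →ₗ[k] Ω'), Matches1 C C' g →
    ∃ Φ : Ω →ₐ[k] Ω',
      (∀ n, ∀ x ∈ C.grading n, Φ x ∈ C'.grading n) ∧
      (∀ x, Φ (C.d x) = C'.d (Φ x)) ∧
      (∀ a, Φ (C.ι a) = C'.ι a) ∧
      (∀ x : C.grading 1, Φ ↑x = g x)

end MaxProl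

/-! ## Complete calculi -/

section Complete

variable {H : Type*} [Ring H] [HopfAlgebra k H]
variable {A : Type*} [Ring A] [Algebra k A]
variable {ΩA : Type*} [Ring ΩA] [Algebra k ΩA]
variable {ΩH : Type*} [Ring ΩH] [Algebra k ΩH]

/-- `D` is an extension of the coaction `ρ : A → A ⊗ H` to a morphism of
differential graded algebras `Ω(A) → Ω(A) ⊗ Ω(H)` (Koszul signs built into
the target); i.e. the calculus `Ω(A)` is *complete* with extension `D`. -/
def IsCompleteExt (S : ComodAlg k H A) (CA : DiffCalc k A ΩA)
    (CH : DiffCalc k H ΩH) (D : ΩA →ₗ[k] ΩA ⊗[k] ΩH) : Prop :=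
  D 1 = 1 ⊗ₜ[k] 1 ∧
  (∀ x y, D (x * y) = koszulMul CA.toDGA CH.toDGA (D x ⊗ₜ[k] D y)) ∧
  D ∘ₗ CA.ι.toLinearMap =
    TensorProduct.map CA.ι.toLinearMap CH.ι.toLinearMap ∘ₗ S.ρ.toLinearMap ∧
  D ∘ₗ CA.d = dTensorGen CA.d CA.toDGA.sign CH.d ∘ₗ D ∧
  (∀ n, ∀ x ∈ CA.grading n, D x ∈ tensorGrading CA.grading CH.grading n)

/-- A complete calculus on the Hopf algebra `H` itself: the comultiplication
extends to a morphism of differential graded algebras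
`Ω(H) → Ω(H) ⊗ Ω(H)`. -/
def IsCompleteExtH (CH : DiffCalc k H ΩH) (D : ΩH →ₗ[k] ΩH ⊗[k] ΩH) : Prop :=
  IsCompleteExt (comulComod k H) CH CH D

/-- The graded counit `ε•` of a complete calculus on `H`: the counit in degree
zero and zero in positive degrees. -/
def epsBul (CH : DiffCalc k H ΩH) : ΩH →ₗ[k] k :=
  Coalgebra.counit (R := k) (A := H) ∘ₗ CH.proj0

end Complete

end NCG
namespace NCG

variable {k : Type*} [CommRing k]

/-! ## First order differential calculi -/

section FODC

variable (k) in
/-- A first order differential calculus `(Γ, d)` on `A`: an `A`-bimodule `Γ`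
(with explicit structure maps) together with a derivation `d : A → Γ`
generating `Γ`. -/
structure FODC (A : Type*) [Ring A] [Algebra k A]
    (Γ : Type*) [AddCommGroup Γ] [Module k Γ] where
  lsmul : A →ₗ[k] Γ →ₗ[k] Γ
  rsmul : A →ₗ[k] Γ →ₗ[k] Γ
  one_lsmul : ∀ x, lsmul 1 x = x
  one_rsmul : ∀ x, rsmul 1 x = x
  mul_lsmul : ∀ a b x, lsmul (a * b) x = lsmul a (lsmul b x)
  mul_rsmul : ∀ a b x, rsmul (a * b) x = rsmul b (rsmul a x)
  lsmul_rsmul : ∀ a b x, lsmul a (rsmul b x) = rsmul b (lsmul a x)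
  d : A →ₗ[k] Γ
  leibniz : ∀ a b, d (a * b) = lsmul a (d b) + rsmul b (d a)
  surj : Submodule.span k {x | ∃ a b, x = lsmul a (d b)} = ⊤

end FODC

/-! ## Diagonal actions on tensor products -/

section ActionHelpers

variable {A H Γ : Type*} [Ring A] [Algebra k A] [Ring H] [Algebra k H]
variable [AddCommGroup Γ] [Module k Γ]

/-- Left action of `A ⊗ H` on `Γ ⊗ H`: `(a ⊗ h) ⊳ (x ⊗ g) = (a ⊳ x) ⊗ h g`. -/
def lactTH (act : A →ₗ[k] Γ →ₗ[k] Γ) :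
    (A ⊗[k] H) →ₗ[k] (Γ ⊗[k] H) →ₗ[k] Γ ⊗[k] H :=
  TensorProduct.curry
    (TensorProduct.map (TensorProduct.lift act) (LinearMap.mul' k H) ∘ₗ
      (TensorProduct.tensorTensorTensorComm k A H Γ H).toLinearMap)

/-- Right action of `A ⊗ H` on `Γ ⊗ H`: `(x ⊗ g) ⊲ (a ⊗ h) = (x ⊲ a) ⊗ g h`. -/
def ractTH (act : A →ₗ[k] Γ →ₗ[k] Γ) :
    (A ⊗[k] H) →ₗ[k] (Γ ⊗[k] H) →ₗ[k] Γ ⊗[k] H :=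
  TensorProduct.curry
    (TensorProduct.map (TensorProduct.lift act)
        (LinearMap.mul' k H ∘ₗ (TensorProduct.comm k H H).toLinearMap) ∘ₗ
      (TensorProduct.tensorTensorTensorComm k A H Γ H).toLinearMap)

/-- Left action of `A ⊗ H` on `A ⊗ Γ`: `(a ⊗ h) ⊳ (c ⊗ x) = a c ⊗ (h ⊳ x)`. -/
def lactHT (act : H →ₗ[k] Γ →ₗ[k] Γ) :
    (A ⊗[k] H) →ₗ[k] (A ⊗[k] Γ) →ₗ[k] A ⊗[k] Γ :=
  TensorProduct.curry
    (TensorProduct.map (LinearMap.mul' k A) (TensorProduct.lift act) ∘ₗ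
      (TensorProduct.tensorTensorTensorComm k A H A Γ).toLinearMap)

/-- Right action of `A ⊗ H` on `A ⊗ Γ`: `(c ⊗ x) ⊲ (a ⊗ h) = c a ⊗ (x ⊲ h)`. -/
def ractHT (act : H →ₗ[k] Γ →ₗ[k] Γ) :
    (A ⊗[k] H) →ₗ[k] (A ⊗[k] Γ) →ₗ[k] A ⊗[k] Γ :=
  TensorProduct.curry
    (TensorProduct.map (LinearMap.mul' k A ∘ₗ (TensorProduct.comm k A A).toLinearMap)
        (TensorProduct.lift act) ∘ₗ
      (TensorProduct.tensorTensorTensorComm k A H A Γ).toLinearMap)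

end ActionHelpers

/-! ## Covariant first order calculi and first order extensions -/

section FODCCov

variable {H : Type*} [Ring H] [Bialgebra k H]
variable {A : Type*} [Ring A] [Algebra k A]
variable {Γ : Type*} [AddCommGroup Γ] [Module k Γ]
variable {ΓH : Type*} [AddCommGroup ΓH] [Module k ΓH]

/-- Right `H`-covariance of a FODC `(Γ, d)` on a comodule algebra `A`. -/
def FODC.IsRightCovariant (S : ComodAlg k H A) (C : FODC k A Γ)
    (ΔΓ : Γ →ₗ[k] Γ ⊗[k] H) : Prop :=
  IsRightCoaction (k := k) ΔΓ ∧
  (∀ a x, ΔΓ (C.lsmul a x) = lactTH C.lsmul (S.ρ a) (ΔΓ x)) ∧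
  (∀ a x, ΔΓ (C.rsmul a x) = ractTH C.rsmul (S.ρ a) (ΔΓ x)) ∧
  ΔΓ ∘ₗ C.d = LinearMap.rTensor H C.d ∘ₗ S.ρ.toLinearMap

/-- Left covariance of a FODC `(Γ, d)` on the Hopf algebra `H` itself. -/
def FODC.IsLeftCovariantH (C : FODC k H Γ) (ΛΓ : Γ →ₗ[k] H ⊗[k] Γ) : Prop :=
  IsLeftCoaction (k := k) ΛΓ ∧
  (∀ h x, ΛΓ (C.lsmul h x) =
    lactHT C.lsmul (Coalgebra.comul (R := k) (A := H) h) (ΛΓ x)) ∧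
  (∀ h x, ΛΓ (C.rsmul h x) =
    ractHT C.rsmul (Coalgebra.comul (R := k) (A := H) h) (ΛΓ x)) ∧
  ΛΓ ∘ₗ C.d = LinearMap.lTensor H C.d ∘ₗ Coalgebra.comul (R := k) (A := H)

/-- Bicovariance of a FODC on `H`: commuting right and left covariant
structures. -/
def FODC.IsBicovariantH (C : FODC k H Γ) (ΔΓ : Γ →ₗ[k] Γ ⊗[k] H)
    (ΛΓ : Γ →ₗ[k] H ⊗[k] Γ) : Prop :=
  FODC.IsRightCovariant (comulComod k H) C ΔΓ ∧ FODC.IsLeftCovariantH C ΛΓ ∧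
  LinearMap.rTensor H ΛΓ ∘ₗ ΔΓ =
    (TensorProduct.assoc k H Γ H).symm.toLinearMap ∘ₗ LinearMap.lTensor H ΔΓ ∘ₗ ΛΓ

/-- `D` is an extension of the coaction `ρ : A → A ⊗ H` to a morphism of first
order differential calculi `Γ_A → Ω¹(A ⊗ H) = (Γ_A ⊗ H) ⊕ (A ⊗ Γ_H)`, i.e.
a map covering `ρ`, `ρ`-bilinear and intertwining `d` with `d_⊗`. -/
def IsFirstOrderExt (S : ComodAlg k H A) (CA : FODC k A Γ) (CHf : FODC k H ΓH)
    (D : Γ →ₗ[k] (Γ ⊗[k] H) × (A ⊗[k] ΓH)) : Prop :=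
  (∀ a x, D (CA.lsmul a x) =
    (lactTH CA.lsmul (S.ρ a) (D x).1, lactHT CHf.lsmul (S.ρ a) (D x).2)) ∧
  (∀ a x, D (CA.rsmul a x) =
    (ractTH CA.rsmul (S.ρ a) (D x).1, ractHT CHf.rsmul (S.ρ a) (D x).2)) ∧
  D ∘ₗ CA.d =
    (LinearMap.rTensor H CA.d ∘ₗ S.ρ.toLinearMap).prod
      (LinearMap.lTensor A CHf.d ∘ₗ S.ρ.toLinearMap)

end FODCCov

/-! ## Vertical forms -/

section Vertical

variable {H : Type*} [Ring H] [HopfAlgebra k H]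
variable {A : Type*} [Ring A] [Algebra k A]
variable {ΩH : Type*} [Ring ΩH] [Algebra k ΩH]

/-- Two-sided multiplication `Ω ⊗ Ω →ₗ (Ω →ₗ Ω)`, `(x ⊗ z) ↦ (y ↦ x y z)`. -/
def bimul (Ω : Type*) [Ring Ω] [Algebra k Ω] : Ω ⊗[k] Ω →ₗ[k] Ω →ₗ[k] Ω :=
  TensorProduct.lift
    ((LinearMap.llcomp k Ω Ω Ω ∘ₗ LinearMap.mul k Ω).compl₂ (LinearMap.mul k Ω).flip)

/-- The right adjoint action `ω ↼ h = S(h₁) ω h₂` of `H` on forms `Ω(H)`. -/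
def adAct (CH : DiffCalc k H ΩH) : H →ₗ[k] ΩH →ₗ[k] ΩH :=
  bimul ΩH ∘ₗ
    TensorProduct.map (CH.ι.toLinearMap ∘ₗ HopfAlgebra.antipode (R := k))
      CH.ι.toLinearMap ∘ₗ
    Coalgebra.comul (R := k) (A := H)

/-- The Cartan–Maurer map `h ↦ ϖ(π_ε(h)) = S(h₁) d(h₂)`. -/
def cartan (CH : DiffCalc k H ΩH) : H →ₗ[k] ΩH :=
  LinearMap.mul' k ΩH ∘ₗ
    TensorProduct.map (CH.ι.toLinearMap ∘ₗ HopfAlgebra.antipode (R := k))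
      (CH.d ∘ₗ CH.ι.toLinearMap) ∘ₗ
    Coalgebra.comul (R := k) (A := H)

/-- The projection `π_Λ : ω ↦ S(ω₋₁) ω₀` onto left-coinvariant forms. -/
def piLam (CH : DiffCalc k H ΩH) (ΛL : ΩH →ₗ[k] H ⊗[k] ΩH) : ΩH →ₗ[k] ΩH :=
  LinearMap.mul' k ΩH ∘ₗ
    TensorProduct.map (CH.ι.toLinearMap ∘ₗ HopfAlgebra.antipode (R := k))
      LinearMap.id ∘ₗ ΛL

/-- The multiplication `(a ⊗ ϑ) ∧ (a' ⊗ ϑ') = a a'₍₀₎ ⊗ (ϑ ↼ a'₍₁₎) ∧ ϑ'` of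
vertical forms, as a map on the ambient space `A ⊗ Ω(H)`. -/
def verMul (S : ComodAlg k H A) (CH : DiffCalc k H ΩH) :
    (A ⊗[k] ΩH) ⊗[k] (A ⊗[k] ΩH) →ₗ[k] A ⊗[k] ΩH :=
  TensorProduct.map (LinearMap.mul' k A)
      (LinearMap.mul' k ΩH ∘ₗ
        LinearMap.rTensor ΩH (TensorProduct.lift (adAct CH).flip) ∘ₗ
        (TensorProduct.assoc k ΩH H ΩH).symm.toLinearMap) ∘ₗ
    (TensorProduct.tensorTensorTensorComm k A ΩH A (H ⊗[k] ΩH)).toLinearMap ∘ₗ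
    LinearMap.lTensor (A ⊗[k] ΩH)
      ((TensorProduct.assoc k A H ΩH).toLinearMap ∘ₗ
        LinearMap.rTensor ΩH S.ρ.toLinearMap)

/-- The vertical differential
`d_v(a ⊗ ϑ) = a ⊗ dϑ + a₍₀₎ ⊗ ϖ(π_ε(a₍₁₎)) ∧ ϑ`. -/
def verD (S : ComodAlg k H A) (CH : DiffCalc k H ΩH) :
    A ⊗[k] ΩH →ₗ[k] A ⊗[k] ΩH :=
  LinearMap.lTensor A CH.d +
    LinearMap.lTensor A
        (LinearMap.mul' k ΩH ∘ₗ LinearMap.rTensor ΩH (cartan CH)) ∘ₗ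
      (TensorProduct.assoc k A H ΩH).toLinearMap ∘ₗ
      LinearMap.rTensor ΩH S.ρ.toLinearMap

/-- The vertical forms `ver• = A ⊗ Λ•` as a submodule of `A ⊗ Ω(H)`. -/
def verSub (A : Type*) [Ring A] [Algebra k A] (ΛL : ΩH →ₗ[k] H ⊗[k] ΩH) :
    Submodule k (A ⊗[k] ΩH) :=
  LinearMap.range (LinearMap.lTensor A (leftCoinv ΛL).subtype)

/-- The degree-`n` vertical forms `ver^n = A ⊗ Λⁿ`. -/
def verSubN (A : Type*) [Ring A] [Algebra k A] (CH : DiffCalc k H ΩH)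
    (ΛL : ΩH →ₗ[k] H ⊗[k] ΩH) (n : ℕ) : Submodule k (A ⊗[k] ΩH) :=
  LinearMap.range (LinearMap.lTensor A ((leftCoinv ΛL ⊓ CH.grading n)).subtype)

end Vertical

/-! ## Quotient multiplications on balanced tensor products -/

section QuotMul

variable {A : Type*} [Ring A] [Algebra k A]

/-- Left multiplication (by `x`) on the first leg of `A ⊗ A`, followed by the
projection onto `A ⊗_B A`. -/
def lmulQaux (B : Submodule k A) (x : A) :
    A ⊗[k] A →ₗ[k] TensorOver (k := k) B :=
  (balRel B).mkQ ∘ₗ LinearMap.rTensor A (LinearMap.mul k A x)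

lemma lmulQaux_rel (B : Submodule k A) (x : A) :
    balRel (k := k) B ≤ LinearMap.ker (lmulQaux B x) := by
  refine Submodule.span_le.mpr ?_
  rintro z ⟨a, a', b, rfl⟩
  simp only [SetLike.mem_coe, LinearMap.mem_ker, lmulQaux, LinearMap.coe_comp,
    Function.comp_apply, map_sub, LinearMap.rTensor_tmul, LinearMap.mul_apply']
  rw [← map_sub, Submodule.mkQ_apply, Submodule.Quotient.mk_eq_zero]
  apply Submodule.subset_span
  exact ⟨x * a, a', b, by rw [mul_assoc]⟩

/-- Left multiplication on the first leg of `A ⊗_B A`. -/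
def lmulQ (B : Submodule k A) :
    A →ₗ[k] TensorOver (k := k) B →ₗ[k] TensorOver (k := k) B where
  toFun x := Submodule.liftQ _ (lmulQaux B x) (lmulQaux_rel B x)
  map_add' x y := by
    apply Submodule.linearMap_qext
    simp only [Submodule.liftQ_mkQ, LinearMap.add_comp, Submodule.liftQ_mkQ]
    simp only [lmulQaux, map_add, LinearMap.rTensor_add, LinearMap.comp_add]
  map_smul' c x := by
    apply Submodule.linearMap_qext
    simp only [RingHom.id_apply, Submodule.liftQ_mkQ, LinearMap.smul_comp,
      Submodule.liftQ_mkQ]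
    simp only [lmulQaux, map_smul, LinearMap.rTensor_smul, LinearMap.comp_smul]

/-- Right multiplication (by `x`) on the second leg of `A ⊗ A`, followed by
the projection onto `A ⊗_B A`. -/
def rmulQaux (B : Submodule k A) (x : A) :
    A ⊗[k] A →ₗ[k] TensorOver (k := k) B :=
  (balRel B).mkQ ∘ₗ LinearMap.lTensor A ((LinearMap.mul k A).flip x)

lemma rmulQaux_rel (B : Submodule k A) (x : A) :
    balRel (k := k) B ≤ LinearMap.ker (rmulQaux B x) := by
  refine Submodule.span_le.mpr ?_
  rintro z ⟨a, a', b, rfl⟩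
  simp only [SetLike.mem_coe, LinearMap.mem_ker, rmulQaux, LinearMap.coe_comp,
    Function.comp_apply, map_sub, LinearMap.lTensor_tmul, LinearMap.flip_apply,
    LinearMap.mul_apply']
  rw [← map_sub, Submodule.mkQ_apply, Submodule.Quotient.mk_eq_zero]
  apply Submodule.subset_span
  exact ⟨a, a' * x, b, by rw [mul_assoc]⟩

/-- Right multiplication on the second leg of `A ⊗_B A`. -/
def rmulQ (B : Submodule k A) :
    A →ₗ[k] TensorOver (k := k) B →ₗ[k] TensorOver (k := k) B where
  toFun x := Submodule.liftQ _ (rmulQaux B x) (rmulQaux_rel B x)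
  map_add' x y := by
    apply Submodule.linearMap_qext
    simp only [Submodule.liftQ_mkQ, LinearMap.add_comp, Submodule.liftQ_mkQ]
    simp only [rmulQaux, map_add, LinearMap.lTensor_add, LinearMap.comp_add]
  map_smul' c x := by
    apply Submodule.linearMap_qext
    simp only [RingHom.id_apply, Submodule.liftQ_mkQ, LinearMap.smul_comp,
      Submodule.liftQ_mkQ]
    simp only [rmulQaux, map_smul, LinearMap.lTensor_smul, LinearMap.comp_smul]

end QuotMul

/-! ## Base, horizontal and balanced graded forms -/

section GradedHG

variable {H : Type*} [Ring H] [HopfAlgebra k H]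
variable {A : Type*} [Ring A] [Algebra k A]
variable {ΩA : Type*} [Ring ΩA] [Algebra k ΩA]
variable {ΩH : Type*} [Ring ΩH] [Algebra k ΩH]

/-- The base forms `Ω•(B)`: forms invariant under the extended coaction. -/
def baseForms (D : ΩA →ₗ[k] ΩA ⊗[k] ΩH) : Submodule k ΩA where
  carrier := {ω | D ω = ω ⊗ₜ[k] 1}
  add_mem' := by
    intro a b ha hb
    simp only [Set.mem_setOf_eq] at *
    rw [map_add, ha, hb, TensorProduct.add_tmul]
  zero_mem' := by simp
  smul_mem' := by
    intro c a ha
    simp only [Set.mem_setOf_eq] at *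
    rw [map_smul, ha, TensorProduct.smul_tmul']

/-- The horizontal forms `hor• = (Δ_A•)⁻¹(Ω•(A) ⊗ H)`. -/
def horForms (CH : DiffCalc k H ΩH) (D : ΩA →ₗ[k] ΩA ⊗[k] ΩH) : Submodule k ΩA :=
  Submodule.comap D (LinearMap.range (LinearMap.lTensor ΩA CH.ι.toLinearMap))

/-- The lift `Ω(A) ⊗ Ω(A) → Ω(A) ⊗ Ω(H)`, `ω ⊗ η ↦ (ω ∧ η₍₀₎) ⊗ η₍₁₎` of the
graded canonical Hopf–Galois map. -/
def chiBulAux (D : ΩA →ₗ[k] ΩA ⊗[k] ΩH) : ΩA ⊗[k] ΩA →ₗ[k] ΩA ⊗[k] ΩH :=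
  LinearMap.rTensor ΩH (LinearMap.mul' k ΩA) ∘ₗ
    (TensorProduct.assoc k ΩA ΩA ΩH).symm.toLinearMap ∘ₗ LinearMap.lTensor ΩA D

end GradedHG

end NCG
namespace NCG

variable {k : Type*} [CommRing k]

section YDHelpers

variable {H : Type*} [Ring H] [HopfAlgebra k H]
variable {ΩH : Type*} [Ring ΩH] [Algebra k ΩH]

/-- `h ↦ h₂ ⊗ (h₁ ⊗ h₃)`. -/
def comul13 : H →ₗ[k] H ⊗[k] (H ⊗[k] H) :=
  (TensorProduct.assoc k H H H).toLinearMap ∘ₗ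
    LinearMap.rTensor H (TensorProduct.comm k H H).toLinearMap ∘ₗ
    (TensorProduct.assoc k H H H).symm.toLinearMap ∘ₗ
    LinearMap.lTensor H (Coalgebra.comul (R := k) (A := H)) ∘ₗ
    Coalgebra.comul (R := k) (A := H)

/-- The sandwich action `(g ⊗ g') ↦ (ω ↦ ι(S(g)) ω ι(g'))`. -/
def sandwich (CH : DiffCalc k H ΩH) : H ⊗[k] H →ₗ[k] ΩH →ₗ[k] ΩH :=
  bimul ΩH ∘ₗ
    TensorProduct.map (CH.ι.toLinearMap ∘ₗ HopfAlgebra.antipode (R := k))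
      CH.ι.toLinearMap

/-- The right hand side `(ϑ₍₁₎ ↼ h₂) ⊗ S(h₁) ϑ₍₂₎ h₃` of the Yetter–Drinfel'd
compatibility condition, evaluated on `t = ϑ₍₁₎ ⊗ ϑ₍₂₎`. -/
def ydRHS (CH : DiffCalc k H ΩH) (h : H) (t : ΩH ⊗[k] ΩH) : ΩH ⊗[k] ΩH :=
  (TensorProduct.map (TensorProduct.lift (adAct CH))
      (TensorProduct.lift (sandwich CH)) ∘ₗ
    (TensorProduct.tensorTensorTensorComm k H (H ⊗[k] H) ΩH ΩH).toLinearMap)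
    (comul13 (k := k) h ⊗ₜ[k] t)

/-- The canonical extension `Δ•_bc` of the comultiplication to a bicovariant
calculus: `Δ` on degree `0` and `Δ_R + _ΩΔ` in positive degrees. -/
def deltaBc (CH : DiffCalc k H ΩH) (ΔR : ΩH →ₗ[k] ΩH ⊗[k] H)
    (ΛL : ΩH →ₗ[k] H ⊗[k] ΩH) : ΩH →ₗ[k] ΩH ⊗[k] ΩH :=
  TensorProduct.map CH.ι.toLinearMap CH.ι.toLinearMap ∘ₗ
      Coalgebra.comul (R := k) (A := H) ∘ₗ CH.proj0 +
    (TensorProduct.map LinearMap.id CH.ι.toLinearMap ∘ₗ ΔR +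
        TensorProduct.map CH.ι.toLinearMap LinearMap.id ∘ₗ ΛL) ∘ₗ
      (LinearMap.id - CH.ι.toLinearMap ∘ₗ CH.proj0)

/-- The map `Ξ : ω ↦ ω₋₂ ⊗ S(ω₋₁) ω₀` from `Ω•(H)` to `H ⊗ Λ•`. -/
def XiMap (CH : DiffCalc k H ΩH) (ΛL : ΩH →ₗ[k] H ⊗[k] ΩH) :
    ΩH →ₗ[k] H ⊗[k] ΩH :=
  LinearMap.lTensor H (piLam CH ΛL) ∘ₗ ΛL

/-- The multiplication map `μ : h ⊗ ϑ ↦ ι(h) ϑ`. -/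
def muMap (CH : DiffCalc k H ΩH) : H ⊗[k] ΩH →ₗ[k] ΩH :=
  LinearMap.mul' k ΩH ∘ₗ TensorProduct.map CH.ι.toLinearMap LinearMap.id

end YDHelpers

end NCG

namespace NCG

section Graded

variable {k : Type*} [CommRing k] {Ω : Type*} [Ring Ω] [Algebra k Ω]

lemma DGA.homogeneous_induction (C : DGA k Ω) {p : Ω → Prop}
    (hom : ∀ n, ∀ x ∈ C.grading n, p x) (add : ∀ x y, p x → p y → p (x + y)) (x : Ω) : p x := by
  let := C.gradedAlgebra
  induction x using DirectSum.Decomposition.inductionOn C.grading with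
  | zero => exact hom 0 0 (zero_mem _)
  | homogeneous m => exact hom _ _ m.2
  | add m m' hm hm' => exact add _ _ hm hm'

lemma DGA.sign_of_mem (C : DGA k Ω) {n : ℕ} {x : Ω} (hx : x ∈ C.grading n) :
    C.sign x = (-1 : k) ^ n • x := by
  let := C.gradedAlgebra
  simp only [DGA.sign, LinearMap.comp_apply, LinearEquiv.coe_coe,
    DirectSum.decomposeLinearEquiv_apply, DirectSum.decompose_of_mem _ hx]
  rw [← DirectSum.lof_eq_of k, DirectSum.toModule_lof]
  rfl

lemma DGA.projN_of_mem (C : DGA k Ω) {n : ℕ} {x : Ω} (hx : x ∈ C.grading n) :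
    C.projN n x = x := by
  let := C.gradedAlgebra
  exact DirectSum.decompose_of_mem_same C.grading hx

variable {Ξ : Type*} [Ring Ξ] [Algebra k Ξ]
variable {M : Type*} [AddCommGroup M] [Module k M]
variable {N : Type*} [AddCommGroup N] [Module k N]

lemma gradedBraid_tmul_of_mem (C : DGA k Ξ) (s : M →ₗ[k] M) {j : ℕ} {θ : Ξ}
    (hθ : θ ∈ C.grading j) (m : M) :
    gradedBraid C s (θ ⊗ₜ m) = (s ^ j) m ⊗ₜ θ := by
  let := C.gradedAlgebra
  simp only [gradedBraid, TensorProduct.lift.tmul, LinearMap.comp_apply, LinearEquiv.coe_coe,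
    DirectSum.decomposeLinearEquiv_apply, DirectSum.decompose_of_mem _ hθ]
  rw [← DirectSum.lof_eq_of k, DirectSum.toModule_lof]
  rfl

lemma koszulMulGen_tmul_of_mem (mulM : M ⊗[k] M →ₗ[k] M) (mulN : Ξ ⊗[k] Ξ →ₗ[k] Ξ)
    (C : DGA k Ξ) (s : M →ₗ[k] M) {j : ℕ} {θ : Ξ} (hθ : θ ∈ C.grading j) (m m' : M) (θ' : Ξ) :
    koszulMulGen mulM mulN C s ((m ⊗ₜ θ) ⊗ₜ (m' ⊗ₜ θ')) =
      mulM (m ⊗ₜ (s ^ j) m') ⊗ₜ mulN (θ ⊗ₜ θ') := by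
  simp [koszulMulGen, gradedBraid_tmul_of_mem C s hθ]

/-- Two elements of `M ⊗ Ξ` may be treated as pure tensors with homogeneous second leg when
checking an identity between bilinear expressions. -/
lemma tmul_tmul_induction (C : DGA k Ξ) {p : M ⊗[k] Ξ → N ⊗[k] Ξ → Prop}
    (tmul : ∀ m j, ∀ θ ∈ C.grading j, ∀ n θ', p (m ⊗ₜ θ) (n ⊗ₜ θ'))
    (add_left : ∀ u u' v, p u v → p u' v → p (u + u') v)
    (add_right : ∀ u v v', p u v → p u v' → p u (v + v'))
    (zero_left : ∀ v, p 0 v) (zero_right : ∀ u, p u 0)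
    (u : M ⊗[k] Ξ) (v : N ⊗[k] Ξ) : p u v := by
  induction v using TensorProduct.induction_on with
  | zero => exact zero_right u
  | add v v' h h' => exact add_right _ _ _ h h'
  | tmul n θ' =>
    induction u using TensorProduct.induction_on with
    | zero => exact zero_left _
    | add u u' h h' => exact add_left _ _ _ h h'
    | tmul m θ =>
      induction θ using C.homogeneous_induction with
      | hom j θ hθ => exact tmul m j θ hθ n θ'
      | add θ₁ θ₂ h₁ h₂ =>
        rw [TensorProduct.tmul_add]
        exact add_left _ _ _ h₁ h₂

lemma rTensor_koszulMulGen {mulM : M ⊗[k] M →ₗ[k] M} {mulM' : N ⊗[k] N →ₗ[k] N}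
    (mulN : Ξ ⊗[k] Ξ →ₗ[k] Ξ) (C : DGA k Ξ) {s : M →ₗ[k] M} {s' : N →ₗ[k] N} (f : M →ₗ[k] N)
    (hmul : ∀ x y, f (mulM (x ⊗ₜ y)) = mulM' (f x ⊗ₜ f y)) (hs : ∀ x, f (s x) = s' (f x))
    (u v : M ⊗[k] Ξ) :
    LinearMap.rTensor Ξ f (koszulMulGen mulM mulN C s (u ⊗ₜ v)) =
      koszulMulGen mulM' mulN C s' (LinearMap.rTensor Ξ f u ⊗ₜ LinearMap.rTensor Ξ f v) := by
  have hpow : ∀ j x, f ((s ^ j) x) = (s' ^ j) (f x) := by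
    intro j
    induction j with
    | zero => intro x; simp
    | succ j ih =>
      intro x
      rw [pow_succ, pow_succ, Module.End.mul_apply, Module.End.mul_apply, ih, hs]
  induction u, v using tmul_tmul_induction C with
  | tmul m j θ hθ n θ' =>
    rw [koszulMulGen_tmul_of_mem _ _ _ _ hθ, LinearMap.rTensor_tmul, LinearMap.rTensor_tmul,
      LinearMap.rTensor_tmul, koszulMulGen_tmul_of_mem _ _ _ _ hθ, hmul, hpow]
  | add_left u u' v h h' =>
    simp only [TensorProduct.add_tmul, map_add, h, h']
  | add_right u v v' h h' => simp only [TensorProduct.tmul_add, map_add, h, h']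
  | zero_left v => simp
  | zero_right u => simp

lemma koszulMulGen_id (C : DGA k Ξ) (u v : Ω ⊗[k] Ξ) :
    koszulMulGen (LinearMap.mul' k Ω) (LinearMap.mul' k Ξ) C LinearMap.id (u ⊗ₜ v) = u * v := by
  induction u, v using tmul_tmul_induction C (M := Ω) (N := Ω) with
  | tmul m j θ hθ n θ' =>
    rw [koszulMulGen_tmul_of_mem _ _ _ _ hθ]
    simp [← Module.End.one_eq_id]
  | add_left u u' v h h' =>
    simp only [TensorProduct.add_tmul, map_add, h, h', add_mul]
  | add_right u v v' h h' => simp only [TensorProduct.tmul_add, map_add, h, h', mul_add]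
  | zero_left v => simp
  | zero_right u => simp

lemma rTensor_dTensorGen {P : Type*} [AddCommGroup P] [Module k P]
    {d s : M →ₗ[k] M} {d' s' : N →ₗ[k] N} (δ : P →ₗ[k] P) (f : M →ₗ[k] N)
    (hd : ∀ x, f (d x) = d' (f x)) (hs : ∀ x, f (s x) = s' (f x)) (u : M ⊗[k] P) :
    LinearMap.rTensor P f (dTensorGen d s δ u) = dTensorGen d' s' δ (LinearMap.rTensor P f u) := by
  induction u using TensorProduct.induction_on with
  | zero => simp
  | add u v h h' => simp only [map_add, h, h']
  | tmul x y => simp [dTensorGen, hd, hs]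

variable {R : Type*} [Ring R] [Algebra k R]

lemma assoc_symm_koszulMul (C : DGA k Ω) (C' : DGA k Ξ) (a b : R) (u v : Ω ⊗[k] Ξ) :
    (TensorProduct.assoc k R Ω Ξ).symm ((a * b) ⊗ₜ koszulMul C C' (u ⊗ₜ v)) =
      koszulMulGen (LinearMap.mul' k (R ⊗[k] Ω)) (LinearMap.mul' k Ξ) C'
        (LinearMap.lTensor R C.sign)
        ((TensorProduct.assoc k R Ω Ξ).symm (a ⊗ₜ u) ⊗ₜ
          (TensorProduct.assoc k R Ω Ξ).symm (b ⊗ₜ v)) := by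
  induction u, v using tmul_tmul_induction C' (M := Ω) (N := Ω) with
  | tmul m j θ hθ n θ' =>
    rw [koszulMul, koszulMulGen_tmul_of_mem _ _ _ _ hθ]
    simp only [TensorProduct.assoc_symm_tmul]
    rw [koszulMulGen_tmul_of_mem _ _ _ _ hθ, LinearMap.lTensor_pow]
    simp
  | add_left u u' v h h' =>
    simp only [TensorProduct.add_tmul, TensorProduct.tmul_add, map_add, h, h']
  | add_right u v v' h h' => simp only [TensorProduct.tmul_add, map_add, h, h']
  | zero_left v => simp
  | zero_right u => simp

lemma assoc_symm_dTensorGen (d : Ω →ₗ[k] Ω) (s : Ω →ₗ[k] Ω) (δ : Ξ →ₗ[k] Ξ)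
    (t : R ⊗[k] (Ω ⊗[k] Ξ)) :
    (TensorProduct.assoc k R Ω Ξ).symm (LinearMap.lTensor R (dTensorGen d s δ) t) =
      dTensorGen (LinearMap.lTensor R d) (LinearMap.lTensor R s) δ
        ((TensorProduct.assoc k R Ω Ξ).symm t) := by
  induction t using TensorProduct.induction_on with
  | zero => simp
  | add u v h h' => simp only [map_add, h, h']
  | tmul a u =>
    induction u using TensorProduct.induction_on with
    | zero => simp
    | add u v h h' => simp only [map_add, TensorProduct.tmul_add, h, h']
    | tmul x y => simp [dTensorGen]

lemma lTensor_sign_of_mem (C : DGA k Ω) {n : ℕ} {t : R ⊗[k] Ω}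
    (ht : t ∈ LinearMap.range (LinearMap.lTensor R (C.grading n).subtype)) :
    LinearMap.lTensor R C.sign t = (-1 : k) ^ n • t := by
  obtain ⟨u, rfl⟩ := ht
  induction u using TensorProduct.induction_on with
  | zero => simp
  | add u v h h' => simp only [map_add, smul_add, h, h']
  | tmul a x => simp [C.sign_of_mem x.2]

lemma lTensor_projN_of_mem (C : DGA k Ω) {n : ℕ} {t : R ⊗[k] Ω}
    (ht : t ∈ LinearMap.range (LinearMap.lTensor R (C.grading n).subtype)) :
    LinearMap.lTensor R (C.projN n) t = t := by
  obtain ⟨u, rfl⟩ := ht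
  induction u using TensorProduct.induction_on with
  | zero => simp
  | add u v h h' => simp only [map_add, h, h']
  | tmul a x => simp [C.projN_of_mem x.2]

end Graded

section Calculus

variable {k : Type*} [CommRing k] {A : Type*} [Ring A] [Algebra k A]
variable {Ω : Type*} [Ring Ω] [Algebra k Ω]

lemma DiffCalc.proj0_ι (C : DiffCalc k A Ω) (a : A) : C.proj0 (C.ι a) = a := by
  let := C.gradedAlgebra
  simp only [DiffCalc.proj0, LinearMap.comp_apply, LinearEquiv.coe_coe,
    DirectSum.decomposeLinearEquiv_apply, DirectSum.decompose_of_mem _ (C.ι_mem a)]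
  rw [← DirectSum.lof_eq_of k, DirectSum.component.lof_self, LinearEquiv.symm_apply_eq]
  rfl

lemma DiffCalc.proj0_of_ne (C : DiffCalc k A Ω) {n : ℕ} (hn : n ≠ 0) {x : Ω}
    (hx : x ∈ C.grading n) : C.proj0 x = 0 := by
  let := C.gradedAlgebra
  simp only [DiffCalc.proj0, LinearMap.comp_apply, LinearEquiv.coe_coe,
    DirectSum.decomposeLinearEquiv_apply, DirectSum.decompose_of_mem _ hx]
  rw [← DirectSum.lof_eq_of k, DirectSum.component.of, dif_neg hn, map_zero]

lemma DiffCalc.proj0_mul (C : DiffCalc k A Ω) (x y : Ω) :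
    C.proj0 (x * y) = C.proj0 x * C.proj0 y := by
  let := C.gradedAlgebra
  induction x using C.homogeneous_induction with
  | add x x' h h' => simp only [add_mul, map_add, h, h']
  | hom m x hx =>
  induction y using C.homogeneous_induction with
  | add y y' h h' => simp only [mul_add, map_add, h, h']
  | hom n y hy =>
  have hxy : x * y ∈ C.grading (m + n) := SetLike.mul_mem_graded hx hy
  by_cases hm : m = 0
  · by_cases hn : n = 0
    · subst hm hn
      obtain ⟨a, rfl⟩ := (C.range_ι x).1 hx
      obtain ⟨b, rfl⟩ := (C.range_ι y).1 hy
      rw [← map_mul, C.proj0_ι, C.proj0_ι, C.proj0_ι]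
    · rw [C.proj0_of_ne (by omega) hxy, C.proj0_of_ne hn hy, mul_zero]
  · rw [C.proj0_of_ne (by omega) hxy, C.proj0_of_ne hm hx, zero_mul]

lemma DiffCalc.proj0_sign (C : DiffCalc k A Ω) (x : Ω) :
    C.proj0 (C.sign x) = C.proj0 x := by
  induction x using C.homogeneous_induction with
  | add x x' h h' => simp only [map_add, h, h']
  | hom n x hx =>
  rw [C.sign_of_mem hx]
  by_cases hn : n = 0
  · simp [hn]
  · rw [map_smul, C.proj0_of_ne hn hx, smul_zero]

lemma DiffCalc.proj0_d (C : DiffCalc k A Ω) (x : Ω) : C.proj0 (C.d x) = 0 := by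
  induction x using C.homogeneous_induction with
  | add x x' h h' => simp only [map_add, h, h', add_zero]
  | hom n x hx => exact C.proj0_of_ne n.succ_ne_zero (C.d_mem n x hx)

lemma DiffCalc.ι_mul_mem (C : DiffCalc k A Ω) (a : A) {n : ℕ} {x : Ω} (hx : x ∈ C.grading n) :
    C.ι a * x ∈ C.grading n := by
  let := C.gradedAlgebra
  simpa using SetLike.mul_mem_graded (C.ι_mem a) hx

lemma DiffCalc.d_ι_mul (C : DiffCalc k A Ω) (a : A) (x : Ω) :
    C.d (C.ι a * x) = C.d (C.ι a) * x + C.ι a * C.d x := by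
  simpa using C.leibniz 0 _ (C.ι_mem a) x

/-- Since a differential calculus is generated in degree zero, induction on forms reduces to
degree zero, products, sums and differentials. -/
lemma DiffCalc.induction (C : DiffCalc k A Ω) {p : Ω → Prop} (ι : ∀ a, p (C.ι a))
    (add : ∀ x y, p x → p y → p (x + y)) (mul : ∀ x y, p x → p y → p (x * y))
    (d : ∀ x, p x → p (C.d x)) (x : Ω) : p x := by
  have hx : x ∈ Algebra.adjoin k (Set.range C.ι ∪ ⇑C.d '' Set.range C.ι) := by
    rw [C.generated]; trivial
  induction hx using Algebra.adjoin_induction with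
  | mem x hx =>
    rcases hx with ⟨a, rfl⟩ | ⟨_, ⟨a, rfl⟩, rfl⟩
    · exact ι a
    · exact d _ (ι a)
  | algebraMap r => exact C.ι.commutes r ▸ ι _
  | add x y _ _ hx hy => exact add x y hx hy
  | mul x y _ _ hx hy => exact mul x y hx hy

/-- A linear map on a differential calculus that is compatible with given multiplication and
differential is determined by its values in degree zero. -/
lemma DiffCalc.ext_of_mul_of_d (C : DiffCalc k A Ω) {X : Type*} [AddCommMonoid X] [Module k X]
    {F G : Ω →ₗ[k] X} (m : X → X → X) (δ : X → X)
    (hF : ∀ x y, F (x * y) = m (F x) (F y)) (hG : ∀ x y, G (x * y) = m (G x) (G y))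
    (hFd : ∀ x, F (C.d x) = δ (F x)) (hGd : ∀ x, G (C.d x) = δ (G x))
    (h : ∀ a, F (C.ι a) = G (C.ι a)) : F = G := by
  ext x
  induction x using C.induction with
  | ι a => exact h a
  | add x y hx hy => rw [map_add, map_add, hx, hy]
  | mul x y hx hy => rw [hF, hG, hx, hy]
  | d x hx => rw [hFd, hGd, hx]

end Calculus
end NCG

namespace NCG

section Convolution

variable {k : Type*} [CommRing k] {R : Type*} [Ring R] [Algebra k R]

/-- The convolution product of linear maps from a coalgebra to an algebra. -/
def conv {C : Type*} [AddCommGroup C] [Module k C] [Coalgebra k C] (f g : C →ₗ[k] R) :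
    C →ₗ[k] R :=
  LinearMap.mul' k R ∘ₗ TensorProduct.map f g ∘ₗ Coalgebra.comul

section Coalgebra

variable {C : Type*} [AddCommGroup C] [Module k C] [Coalgebra k C]

lemma conv_assoc (f g h : C →ₗ[k] R) : conv (conv f g) h = conv f (conv g h) :=
  congrArg WithConv.ofConv
    (mul_assoc (WithConv.toConv f) (WithConv.toConv g) (WithConv.toConv h))

/-- The unit of the convolution product. -/
def convUnit (k C R : Type*) [CommRing k] [AddCommGroup C] [Module k C] [Coalgebra k C]
    [Ring R] [Algebra k R] : C →ₗ[k] R := Algebra.linearMap k R ∘ₗ Coalgebra.counit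

lemma algHom_comp_conv {R' : Type*} [Ring R'] [Algebra k R'] (φ : R →ₐ[k] R')
    (f g : C →ₗ[k] R) :
    φ.toLinearMap ∘ₗ conv f g = conv (φ.toLinearMap ∘ₗ f) (φ.toLinearMap ∘ₗ g) := by
  simp [conv, TensorProduct.map_comp, ← LinearMap.comp_assoc, AlgHom.comp_mul']

lemma convUnit_conv (f : C →ₗ[k] R) : conv (convUnit k C R) f = f :=
  congrArg WithConv.ofConv (one_mul (WithConv.toConv f))

end Coalgebra

/-- The convolution action of linear maps on a coalgebra on linear maps on a left comodule. -/
def leftConv {C : Type*} [AddCommGroup C] [Module k C] {M : Type*} [AddCommGroup M] [Module k M]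
    (lam : M →ₗ[k] C ⊗[k] M) (f : C →ₗ[k] R) (g : M →ₗ[k] R) : M →ₗ[k] R :=
  LinearMap.mul' k R ∘ₗ TensorProduct.map f g ∘ₗ lam

lemma algHom_comp_leftConv {C : Type*} [AddCommGroup C] [Module k C] {M : Type*} [AddCommGroup M]
    [Module k M] {lam : M →ₗ[k] C ⊗[k] M} {R' : Type*} [Ring R'] [Algebra k R'] (φ : R →ₐ[k] R')
    (f : C →ₗ[k] R) (g : M →ₗ[k] R) :
    φ.toLinearMap ∘ₗ leftConv lam f g =
      leftConv lam (φ.toLinearMap ∘ₗ f) (φ.toLinearMap ∘ₗ g) := by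
  simp [leftConv, TensorProduct.map_comp, ← LinearMap.comp_assoc, AlgHom.comp_mul']

section Comodule

variable {C : Type*} [AddCommGroup C] [Module k C] [Coalgebra k C]
variable {M : Type*} [AddCommGroup M] [Module k M] {lam : M →ₗ[k] C ⊗[k] M}

lemma IsLeftCoaction.lTensor_apply (h : IsLeftCoaction (k := k) lam) (m : M) :
    LinearMap.lTensor C lam (lam m) =
      TensorProduct.assoc k C C M (LinearMap.rTensor M Coalgebra.comul (lam m)) := by
  rw [← LinearEquiv.symm_apply_eq]
  exact LinearMap.congr_fun h.2 m

lemma leftConv_leftConv (hlam : IsLeftCoaction (k := k) lam) (f g : C →ₗ[k] R) (h : M →ₗ[k] R) :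
    leftConv lam f (leftConv lam g h) = leftConv lam (conv f g) h := by
  have key : ∀ u : C ⊗[k] M,
      LinearMap.mul' k R (TensorProduct.map f (LinearMap.mul' k R ∘ₗ TensorProduct.map g h)
        (TensorProduct.assoc k C C M (LinearMap.rTensor M Coalgebra.comul u))) =
      LinearMap.mul' k R (TensorProduct.map (conv f g) h u) := by
    intro u
    induction u using TensorProduct.induction_on with
    | zero => simp
    | add u v hu hv => simp only [map_add, hu, hv]
    | tmul c m =>
      simp only [LinearMap.rTensor_tmul, TensorProduct.map_tmul, conv, LinearMap.comp_apply]
      induction Coalgebra.comul (R := k) c using TensorProduct.induction_on with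
      | zero => simp
      | add u v hu hv => simp only [map_add, TensorProduct.add_tmul, hu, hv]
      | tmul x y => simp [mul_assoc]
  ext m
  refine Eq.trans ?_ (key (lam m))
  rw [← hlam.lTensor_apply, LinearMap.lTensor, TensorProduct.map_map, LinearMap.comp_id]
  rfl

lemma convUnit_leftConv (hlam : IsLeftCoaction (k := k) lam) (g : M →ₗ[k] R) :
    leftConv lam (convUnit k C R) g = g := by
  ext m
  have h := LinearMap.congr_fun hlam.1 m
  have key : ∀ u : C ⊗[k] M, LinearMap.mul' k R (TensorProduct.map (convUnit k C R) g u) =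
      LinearMap.mul' k R (TensorProduct.map (Algebra.linearMap k R) g
        (LinearMap.rTensor M Coalgebra.counit u)) := by
    intro u
    rw [LinearMap.rTensor, TensorProduct.map_map, LinearMap.comp_id, convUnit]
  refine (key (lam m)).trans ?_
  rw [LinearMap.comp_apply] at h
  rw [h]
  simp

end Comodule

section Hopf

variable {H : Type*} [Ring H] [HopfAlgebra k H]

lemma conv_algHom_antipode (φ : H →ₐ[k] R) :
    conv φ.toLinearMap (φ.toLinearMap ∘ₗ HopfAlgebra.antipode (R := k)) = convUnit k H R := by
  have h : conv LinearMap.id (HopfAlgebra.antipode k (A := H)) = convUnit k H H :=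
    HopfAlgebra.mul_antipode_lTensor_comul
  have h' := algHom_comp_conv φ LinearMap.id (HopfAlgebra.antipode k (A := H))
  rw [h, LinearMap.comp_id] at h'
  rw [← h']
  ext x
  simp [convUnit]

lemma conv_antipode_algHom (φ : H →ₐ[k] R) :
    conv (φ.toLinearMap ∘ₗ HopfAlgebra.antipode (R := k)) φ.toLinearMap = convUnit k H R := by
  have h : conv (HopfAlgebra.antipode k (A := H)) LinearMap.id = convUnit k H H :=
    HopfAlgebra.mul_antipode_rTensor_comul
  have h' := algHom_comp_conv φ (HopfAlgebra.antipode k (A := H)) LinearMap.id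
  rw [h, LinearMap.comp_id] at h'
  rw [← h']
  ext x
  simp [convUnit]

end Hopf

end Convolution

section CoactMul

variable {k : Type*} [CommRing k] {H : Type*} [Ring H] [Bialgebra k H]
variable {A : Type*} [Ring A] [Algebra k A] {R : Type*} [Ring R] [Algebra k R]

lemma ComodAlg.rTensor_ρ (S : ComodAlg k H A) (a : A) :
    LinearMap.rTensor H S.ρ.toLinearMap (S.ρ a) =
      (TensorProduct.assoc k A H H).symm (LinearMap.lTensor A Coalgebra.comul (S.ρ a)) := by
  rw [LinearEquiv.eq_symm_apply]
  exact LinearMap.congr_fun S.coaction.2 a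

/-- The map `a ⊗ ω ↦ a₍₀₎ ⊗ f(a₍₁₎) ω`. -/
def coactMul (S : ComodAlg k H A) (f : H →ₗ[k] R) : A ⊗[k] R →ₗ[k] A ⊗[k] R :=
  LinearMap.lTensor A (LinearMap.mul' k R ∘ₗ LinearMap.rTensor R f) ∘ₗ
    (TensorProduct.assoc k A H R).toLinearMap ∘ₗ LinearMap.rTensor R S.ρ.toLinearMap

lemma coactMul_tmul (S : ComodAlg k H A) (f : H →ₗ[k] R) (a : A) (ω : R) :
    coactMul S f (a ⊗ₜ ω) = LinearMap.lTensor A f (S.ρ a) * (1 ⊗ₜ ω) := by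
  simp only [coactMul, LinearMap.comp_apply, LinearMap.rTensor_tmul, AlgHom.toLinearMap_apply,
    LinearEquiv.coe_coe]
  induction S.ρ a using TensorProduct.induction_on with
  | zero => simp
  | add u v hu hv => simp only [map_add, TensorProduct.add_tmul, hu, hv, add_mul]
  | tmul x y => simp

lemma coactMul_mul_one_tmul (S : ComodAlg k H A) (f : H →ₗ[k] R) (t : A ⊗[k] R) (ω : R) :
    coactMul S f (t * (1 ⊗ₜ ω)) = coactMul S f t * (1 ⊗ₜ ω) := by
  induction t using TensorProduct.induction_on with
  | zero => simp
  | add u v hu hv => simp only [map_add, add_mul, hu, hv]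
  | tmul a η =>
    rw [Algebra.TensorProduct.tmul_mul_tmul, mul_one, coactMul_tmul, coactMul_tmul, mul_assoc,
      Algebra.TensorProduct.tmul_mul_tmul, mul_one]

lemma coactMul_lTensor_ρ (S : ComodAlg k H A) (f g : H →ₗ[k] R) (a : A) :
    coactMul S f (LinearMap.lTensor A g (S.ρ a)) = LinearMap.lTensor A (conv f g) (S.ρ a) := by
  have h₁ : ∀ u : A ⊗[k] H, coactMul S f (LinearMap.lTensor A g u) =
      LinearMap.lTensor A (LinearMap.mul' k R ∘ₗ TensorProduct.map f g)
        (TensorProduct.assoc k A H H (LinearMap.rTensor H S.ρ.toLinearMap u)) := by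
    intro u
    induction u using TensorProduct.induction_on with
    | zero => simp
    | add u v hu hv => simp only [map_add, hu, hv]
    | tmul x y =>
      rw [LinearMap.lTensor_tmul, coactMul_tmul, LinearMap.rTensor_tmul]
      simp only [AlgHom.toLinearMap_apply]
      induction S.ρ x using TensorProduct.induction_on with
      | zero => simp
      | add u v hu hv => simp only [map_add, TensorProduct.add_tmul, hu, hv, add_mul]
      | tmul x y => simp
  rw [h₁, S.rTensor_ρ, LinearEquiv.apply_symm_apply, ← LinearMap.comp_apply,
    ← LinearMap.lTensor_comp]
  rfl

lemma coactMul_coactMul (S : ComodAlg k H A) (f g : H →ₗ[k] R) (t : A ⊗[k] R) :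
    coactMul S f (coactMul S g t) = coactMul S (conv f g) t := by
  induction t using TensorProduct.induction_on with
  | zero => simp
  | add u v hu hv => simp only [map_add, hu, hv]
  | tmul a ω =>
    rw [coactMul_tmul, coactMul_mul_one_tmul, coactMul_lTensor_ρ, ← coactMul_tmul]

lemma coactMul_convUnit (S : ComodAlg k H A) (t : A ⊗[k] R) :
    coactMul S (convUnit k H R) t = t := by
  induction t using TensorProduct.induction_on with
  | zero => simp
  | add u v hu hv => simp only [map_add, hu, hv]
  | tmul a ω =>
    have h := LinearMap.congr_fun S.coaction.1 a
    simp only [LinearMap.comp_apply, AlgHom.toLinearMap_apply] at h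
    rw [coactMul_tmul, convUnit, LinearMap.lTensor_comp, LinearMap.comp_apply, h]
    simp

end CoactMul

section VerTwist

variable {k : Type*} [CommRing k] {H : Type*} [Ring H] [HopfAlgebra k H]
variable {A : Type*} [Ring A] [Algebra k A] {R : Type*} [Ring R] [Algebra k R]

/-- The bijection `a ⊗ ω ↦ a₍₀₎ ⊗ φ(a₍₁₎) ω`, with inverse `a ⊗ ω ↦ a₍₀₎ ⊗ φ(S(a₍₁₎)) ω`. -/
def twist (S : ComodAlg k H A) (φ : H →ₐ[k] R) : (A ⊗[k] R) ≃ₗ[k] A ⊗[k] R :=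
  LinearEquiv.ofLinearMap (coactMul S φ.toLinearMap)
    (coactMul S (φ.toLinearMap ∘ₗ HopfAlgebra.antipode (R := k)))
    (LinearMap.ext fun t => by
      rw [LinearMap.comp_apply, coactMul_coactMul, conv_algHom_antipode, coactMul_convUnit]; rfl)
    (LinearMap.ext fun t => by
      rw [LinearMap.comp_apply, coactMul_coactMul, conv_antipode_algHom, coactMul_convUnit]; rfl)

lemma twist_apply (S : ComodAlg k H A) (φ : H →ₐ[k] R) (t : A ⊗[k] R) :
    twist S φ t = coactMul S φ.toLinearMap t := rfl

lemma twist_symm_apply (S : ComodAlg k H A) (φ : H →ₐ[k] R) (t : A ⊗[k] R) :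
    (twist S φ).symm t = coactMul S (φ.toLinearMap ∘ₗ HopfAlgebra.antipode (R := k)) t := rfl

/-- The algebra morphism `a ↦ a₍₀₎ ⊗ φ(a₍₁₎)`. -/
def ComodAlg.coactHom (S : ComodAlg k H A) (φ : H →ₐ[k] R) : A →ₐ[k] A ⊗[k] R :=
  (Algebra.TensorProduct.map (AlgHom.id k A) φ).comp S.ρ

lemma ComodAlg.coactHom_apply (S : ComodAlg k H A) (φ : H →ₐ[k] R) (a : A) :
    S.coactHom φ a = LinearMap.lTensor A φ.toLinearMap (S.ρ a) := rfl

lemma twist_tmul (S : ComodAlg k H A) (φ : H →ₐ[k] R) (a : A) (ω : R) :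
    twist S φ (a ⊗ₜ ω) = S.coactHom φ a * (1 ⊗ₜ ω) :=
  coactMul_tmul S _ a ω

lemma twist_tmul_one (S : ComodAlg k H A) (φ : H →ₐ[k] R) (a : A) :
    twist S φ (a ⊗ₜ 1) = S.coactHom φ a := by
  rw [twist_tmul, ← Algebra.TensorProduct.one_def, mul_one]

lemma twist_tmul_one_mul (S : ComodAlg k H A) (φ : H →ₐ[k] R) (a : A) (t : A ⊗[k] R) :
    twist S φ ((a ⊗ₜ 1) * t) = S.coactHom φ a * twist S φ t := by
  induction t using TensorProduct.induction_on with
  | zero => simp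
  | add u v hu hv => simp only [map_add, mul_add, hu, hv]
  | tmul b ω =>
    rw [Algebra.TensorProduct.tmul_mul_tmul, one_mul, twist_tmul, twist_tmul, map_mul, mul_assoc]

lemma coactMul_mulLeft (S : ComodAlg k H A) (f : H →ₗ[k] R) (ω : R) (t : A ⊗[k] R) :
    coactMul S (LinearMap.mulLeft k ω ∘ₗ f) t = (1 ⊗ₜ ω) * coactMul S f t := by
  have key : ∀ u : A ⊗[k] H, LinearMap.lTensor A (LinearMap.mulLeft k ω ∘ₗ f) u =
      (1 ⊗ₜ ω) * LinearMap.lTensor A f u := by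
    intro u
    induction u using TensorProduct.induction_on with
    | zero => simp
    | add u v hu hv => simp only [map_add, mul_add, hu, hv]
    | tmul b h => simp
  induction t using TensorProduct.induction_on with
  | zero => simp
  | add u v hu hv => simp only [map_add, mul_add, hu, hv]
  | tmul b η => rw [coactMul_tmul, coactMul_tmul, key, mul_assoc]

variable {Ω : Type*} [Ring Ω] [Algebra k Ω] (S : ComodAlg k H A) (CH : DiffCalc k H Ω)

lemma adAct_flip (ω : Ω) : (adAct CH).flip ω =
    conv (CH.ι.toLinearMap ∘ₗ HopfAlgebra.antipode (R := k))
      (LinearMap.mulLeft k ω ∘ₗ CH.ι.toLinearMap) := by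
  ext h
  simp only [adAct, conv, LinearMap.flip_apply, LinearMap.comp_apply]
  induction Coalgebra.comul (R := k) h using TensorProduct.induction_on with
  | zero => simp
  | add u v hu hv => simp only [map_add, LinearMap.add_apply, hu, hv]
  | tmul x y => simp [bimul]

lemma conv_ι_adAct_flip (ω : Ω) : conv CH.ι.toLinearMap ((adAct CH).flip ω) =
    LinearMap.mulLeft k ω ∘ₗ CH.ι.toLinearMap := by
  rw [adAct_flip, ← conv_assoc, conv_algHom_antipode, convUnit_conv]

lemma conv_ι_cartan : conv CH.ι.toLinearMap (cartan CH) = CH.d ∘ₗ CH.ι.toLinearMap := by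
  change conv _ (conv _ _) = _
  rw [← conv_assoc, conv_algHom_antipode, convUnit_conv]

lemma verMul_tmul (a : A) (ω : Ω) (t : A ⊗[k] Ω) :
    verMul S CH ((a ⊗ₜ ω) ⊗ₜ t) = (a ⊗ₜ 1) * coactMul S ((adAct CH).flip ω) t := by
  induction t using TensorProduct.induction_on with
  | zero => simp
  | add u v hu hv => simp only [map_add, TensorProduct.tmul_add, mul_add, hu, hv]
  | tmul b η =>
    rw [coactMul_tmul]
    simp only [verMul, LinearMap.comp_apply, LinearMap.lTensor_tmul, LinearMap.rTensor_tmul,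
      AlgHom.toLinearMap_apply, LinearEquiv.coe_coe]
    induction S.ρ b using TensorProduct.induction_on with
    | zero => simp
    | add u v hu hv =>
      simp only [map_add, TensorProduct.add_tmul, TensorProduct.tmul_add, mul_add, add_mul, hu, hv]
    | tmul x y => simp

lemma verMul_tmul_one (a : A) (t : A ⊗[k] Ω) :
    verMul S CH ((a ⊗ₜ 1) ⊗ₜ t) = (a ⊗ₜ 1) * t := by
  have h : (adAct CH).flip 1 = convUnit k H Ω := by
    rw [adAct_flip, ← conv_antipode_algHom CH.ι]
    congr 1
    ext x
    simp
  rw [verMul_tmul, h, coactMul_convUnit]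

/-- The twist carries the product of vertical forms to the product of `A ⊗ Ω(H)`. -/
lemma twist_verMul (s t : A ⊗[k] Ω) :
    twist S CH.ι (verMul S CH (s ⊗ₜ t)) = twist S CH.ι s * twist S CH.ι t := by
  induction s using TensorProduct.induction_on with
  | zero => simp
  | add u v hu hv => simp only [map_add, TensorProduct.add_tmul, add_mul, hu, hv]
  | tmul a ω =>
    rw [verMul_tmul, twist_tmul_one_mul, twist_apply, coactMul_coactMul, conv_ι_adAct_flip,
      coactMul_mulLeft, ← twist_apply, twist_tmul, mul_assoc]

/-- The twist carries the vertical differential to `id ⊗ d`. -/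
lemma twist_verD (t : A ⊗[k] Ω) :
    twist S CH.ι (verD S CH t) = LinearMap.lTensor A CH.d (twist S CH.ι t) := by
  have h : verD S CH t = LinearMap.lTensor A CH.d t + coactMul S (cartan CH) t := rfl
  rw [h, map_add, twist_apply, twist_apply, coactMul_coactMul, conv_ι_cartan, twist_apply]
  clear h
  induction t using TensorProduct.induction_on with
  | zero => simp
  | add u v hu hv => simp only [map_add, ← hu, ← hv]; abel
  | tmul a ω =>
    rw [LinearMap.lTensor_tmul, coactMul_tmul, coactMul_tmul, coactMul_tmul]
    induction S.ρ a using TensorProduct.induction_on with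
    | zero => simp
    | add u v hu hv => simp only [map_add, add_mul, ← hu, ← hv]; abel
    | tmul x y => simp [CH.d_ι_mul, TensorProduct.tmul_add, add_comm]

lemma twist_lTensor_sign (t : A ⊗[k] Ω) :
    twist S CH.ι (LinearMap.lTensor A CH.sign t) =
      LinearMap.lTensor A CH.sign (twist S CH.ι t) := by
  have key : ∀ (h : H) (ω : Ω), CH.sign (CH.ι h * ω) = CH.ι h * CH.sign ω := by
    intro h ω
    induction ω using CH.homogeneous_induction with
    | add x y hx hy => simp only [mul_add, map_add, hx, hy]
    | hom n x hx => rw [CH.sign_of_mem hx, CH.sign_of_mem (CH.ι_mul_mem h hx), mul_smul_comm]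
  induction t using TensorProduct.induction_on with
  | zero => simp
  | add u v hu hv => simp only [map_add, hu, hv]
  | tmul a ω =>
    rw [LinearMap.lTensor_tmul, twist_tmul, twist_tmul, S.coactHom_apply]
    induction S.ρ a using TensorProduct.induction_on with
    | zero => simp
    | add u v hu hv => simp only [map_add, add_mul, hu, hv]
    | tmul x y => simp [key]

end VerTwist

section PiLam

variable {k : Type*} [CommRing k] {H : Type*} [Ring H] [HopfAlgebra k H]
variable {Ω : Type*} [Ring Ω] [Algebra k Ω] {CH : DiffCalc k H Ω} {ΛL : Ω →ₗ[k] H ⊗[k] Ω}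

lemma piLam_eq_leftConv : piLam CH ΛL =
    leftConv ΛL (CH.ι.toLinearMap ∘ₗ HopfAlgebra.antipode (R := k)) LinearMap.id := rfl

lemma piLam_of_mem_leftCoinv {ϑ : Ω} (h : ϑ ∈ leftCoinv ΛL) : piLam CH ΛL ϑ = ϑ := by
  have h : ΛL ϑ = 1 ⊗ₜ ϑ := h
  simp [piLam, h]

/-- The left coaction of a left-covariant calculus as an algebra morphism. -/
def IsLeftCovariantH.algHom (hL : IsLeftCovariantH CH ΛL) : Ω →ₐ[k] H ⊗[k] Ω :=
  AlgHom.ofLinearMap ΛL hL.2.1 hL.2.2.1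

lemma leftConv_ι_piLam (hL : IsLeftCovariantH CH ΛL) :
    leftConv ΛL CH.ι.toLinearMap (piLam CH ΛL) = LinearMap.id := by
  rw [piLam_eq_leftConv, leftConv_leftConv hL.1, conv_algHom_antipode, convUnit_leftConv hL.1]

lemma piLam_mem_leftCoinv (hL : IsLeftCovariantH CH ΛL) (ω : Ω) :
    piLam CH ΛL ω ∈ leftCoinv ΛL := by
  let i : Ω →ₐ[k] H ⊗[k] Ω := Algebra.TensorProduct.includeRight
  let j : H →ₐ[k] H ⊗[k] Ω := hL.algHom.comp CH.ι
  have h₁ : leftConv ΛL j.toLinearMap (i.toLinearMap ∘ₗ piLam CH ΛL) = ΛL := by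
    have hj : j.toLinearMap = LinearMap.lTensor H CH.ι.toLinearMap ∘ₗ Coalgebra.comul :=
      hL.2.2.2.2.2
    have key : ∀ u : H ⊗[k] Ω, LinearMap.mul' k (H ⊗[k] Ω)
        (TensorProduct.map j.toLinearMap (i.toLinearMap ∘ₗ piLam CH ΛL) u) =
        LinearMap.lTensor H (LinearMap.mul' k Ω ∘ₗ
            TensorProduct.map CH.ι.toLinearMap (piLam CH ΛL))
          (TensorProduct.assoc k H H Ω (LinearMap.rTensor Ω Coalgebra.comul u)) := by
      intro u
      rw [hj]
      induction u using TensorProduct.induction_on with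
      | zero => simp
      | add u v hu hv => simp only [map_add, hu, hv]
      | tmul h ω =>
        simp only [TensorProduct.map_tmul, LinearMap.rTensor_tmul, LinearMap.comp_apply]
        induction Coalgebra.comul (R := k) h using TensorProduct.induction_on with
        | zero => simp
        | add u v hu hv => simp only [map_add, TensorProduct.add_tmul, hu, hv]
        | tmul x y => simp [i]
    ext1 ω
    refine (key (ΛL ω)).trans ?_
    rw [← hL.1.lTensor_apply, ← LinearMap.comp_apply, ← LinearMap.lTensor_comp,
      LinearMap.comp_assoc]
    change LinearMap.lTensor H (leftConv ΛL _ _) _ = _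
    rw [leftConv_ι_piLam hL, LinearMap.lTensor_id, LinearMap.id_apply]
  have h₂ : ΛL ∘ₗ piLam CH ΛL = i.toLinearMap ∘ₗ piLam CH ΛL := by
    have h := algHom_comp_leftConv (lam := ΛL) hL.algHom
      (CH.ι.toLinearMap ∘ₗ HopfAlgebra.antipode (R := k)) LinearMap.id
    have hΛ : hL.algHom.toLinearMap = ΛL := rfl
    rw [LinearMap.comp_id, hΛ, ← piLam_eq_leftConv] at h
    rw [h]
    nth_rw 3 [← h₁]
    rw [leftConv_leftConv hL.1]
    change leftConv ΛL (conv (j.toLinearMap ∘ₗ HopfAlgebra.antipode (R := k)) _) _ = _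
    rw [conv_antipode_algHom, convUnit_leftConv hL.1]
  exact LinearMap.congr_fun h₂ ω

lemma piLam_mem_grading (hL : IsLeftCovariantH CH ΛL) {n : ℕ} {ω : Ω} (hω : ω ∈ CH.grading n) :
    piLam CH ΛL ω ∈ CH.grading n := by
  obtain ⟨u, hu⟩ := hL.2.2.2.1 n ω hω
  simp only [piLam, LinearMap.comp_apply, ← hu]
  clear hu
  induction u using TensorProduct.induction_on with
  | zero => simp
  | add u v hu hv => simpa only [map_add] using add_mem hu hv
  | tmul h η => simpa using CH.ι_mul_mem _ η.2

end PiLam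
end NCG

namespace NCG

section LTensor

variable {k : Type*} [CommRing k] {A : Type*} [Ring A] [Algebra k A]
variable {Ω : Type*} [Ring Ω] [Algebra k Ω]

lemma lTensor_tmul_one_mul (f : Ω →ₗ[k] Ω) (a : A) (t : A ⊗[k] Ω) :
    LinearMap.lTensor A f ((a ⊗ₜ 1) * t) = (a ⊗ₜ 1) * LinearMap.lTensor A f t := by
  induction t using TensorProduct.induction_on with
  | zero => simp
  | add u v hu hv => simp only [map_add, mul_add, hu, hv]
  | tmul b ω => simp

lemma lTensor_mem_range {M N : Type*} [AddCommGroup M] [Module k M] [AddCommGroup N] [Module k N]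
    {P : Submodule k M} {Q : Submodule k N} {f : M →ₗ[k] N} (h : ∀ x ∈ P, f x ∈ Q) {t : A ⊗[k] M}
    (ht : t ∈ LinearMap.range (LinearMap.lTensor A P.subtype)) :
    LinearMap.lTensor A f t ∈ LinearMap.range (LinearMap.lTensor A Q.subtype) := by
  obtain ⟨u, rfl⟩ := ht
  refine ⟨LinearMap.lTensor A (f.restrict h) u, ?_⟩
  rw [← LinearMap.comp_apply, ← LinearMap.comp_apply, ← LinearMap.lTensor_comp,
    ← LinearMap.lTensor_comp]
  rfl

end LTensor

section VerticalProjection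

variable {k : Type*} [CommRing k] {H : Type*} [Ring H] [HopfAlgebra k H]
variable {A : Type*} [Ring A] [Algebra k A] {S : ComodAlg k H A}
variable {ΩH : Type*} [Ring ΩH] [Algebra k ΩH] {CH : DiffCalc k H ΩH}
variable {ΛL : ΩH →ₗ[k] H ⊗[k] ΩH} {DH : ΩH →ₗ[k] ΩH ⊗[k] ΩH}
variable {ΩA : Type*} [Ring ΩA] [Algebra k ΩA] {CA : DiffCalc k A ΩA}
variable {DA : ΩA →ₗ[k] ΩA ⊗[k] ΩH}

/-- The component of a coaction on forms with values in `Ω⁰(A) ⊗ Ω(H) = A ⊗ Ω(H)`. -/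
def zeroComponent (CA : DiffCalc k A ΩA) (DA : ΩA →ₗ[k] ΩA ⊗[k] ΩH) : ΩA →ₗ[k] A ⊗[k] ΩH :=
  LinearMap.rTensor ΩH CA.proj0 ∘ₗ DA

/-- The vertical projection `(id ⊗ π_Λ) ∘ Δ_A•`. -/
def verProj (CA : DiffCalc k A ΩA) (CH : DiffCalc k H ΩH) (ΛL : ΩH →ₗ[k] H ⊗[k] ΩH)
    (DA : ΩA →ₗ[k] ΩA ⊗[k] ΩH) : ΩA →ₗ[k] A ⊗[k] ΩH :=
  LinearMap.lTensor A (piLam CH ΛL) ∘ₗ zeroComponent CA DA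

/-- The coaction `a ⊗ ϑ ↦ (a₍₀₎ ⊗ ϑ₍₁₎) ⊗ a₍₁₎ ϑ₍₂₎` on vertical forms. -/
def verCoact (S : ComodAlg k H A) (CH : DiffCalc k H ΩH) (DH : ΩH →ₗ[k] ΩH ⊗[k] ΩH) :
    A ⊗[k] ΩH →ₗ[k] (A ⊗[k] ΩH) ⊗[k] ΩH :=
  LinearMap.rTensor ΩH (twist S CH.ι).symm.toLinearMap ∘ₗ
    (TensorProduct.assoc k A ΩH ΩH).symm.toLinearMap ∘ₗ LinearMap.lTensor A DH ∘ₗ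
      (twist S CH.ι).toLinearMap

namespace IsCompleteExt

variable (hDA : IsCompleteExt S CA CH DA)
include hDA

lemma map_mul (x y : ΩA) : DA (x * y) = koszulMul CA.toDGA CH.toDGA (DA x ⊗ₜ DA y) := hDA.2.1 x y

lemma map_ι (a : A) : DA (CA.ι a) =
    TensorProduct.map CA.ι.toLinearMap CH.ι.toLinearMap (S.ρ a) :=
  LinearMap.congr_fun hDA.2.2.1 a

lemma map_d (x : ΩA) : DA (CA.d x) = dTensorGen CA.d CA.sign CH.d (DA x) :=
  LinearMap.congr_fun hDA.2.2.2.1 x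

lemma zeroComponent_ι (a : A) : zeroComponent CA DA (CA.ι a) = S.coactHom CH.ι a := by
  rw [zeroComponent, LinearMap.comp_apply, hDA.map_ι, S.coactHom_apply]
  induction S.ρ a using TensorProduct.induction_on with
  | zero => simp
  | add u v hu hv => simp only [map_add, hu, hv]
  | tmul x y => simp [CA.proj0_ι]

lemma zeroComponent_mul (x y : ΩA) :
    zeroComponent CA DA (x * y) = zeroComponent CA DA x * zeroComponent CA DA y := by
  simp only [zeroComponent, LinearMap.comp_apply]
  rw [hDA.map_mul, koszulMul, rTensor_koszulMulGen (mulM' := LinearMap.mul' k A)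
    (s' := LinearMap.id) _ _ CA.proj0 (fun x y => by simp [CA.proj0_mul]) CA.proj0_sign,
    koszulMulGen_id]

lemma zeroComponent_d (x : ΩA) :
    zeroComponent CA DA (CA.d x) = LinearMap.lTensor A CH.d (zeroComponent CA DA x) := by
  simp only [zeroComponent, LinearMap.comp_apply]
  rw [hDA.map_d, rTensor_dTensorGen (d' := 0) (s' := LinearMap.id) _ CA.proj0 CA.proj0_d
    CA.proj0_sign]
  simp [dTensorGen, LinearMap.lTensor]

lemma zeroComponent_mem {n : ℕ} {x : ΩA} (hx : x ∈ CA.grading n) :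
    zeroComponent CA DA x ∈ LinearMap.range (LinearMap.lTensor A (CH.grading n).subtype) := by
  have hle : tensorGrading CA.grading CH.grading n ≤
      (LinearMap.range (LinearMap.lTensor A (CH.grading n).subtype)).comap
        (LinearMap.rTensor ΩH CA.proj0) := by
    refine iSup_le fun ⟨⟨p, q⟩, hpq⟩ => ?_
    rintro _ ⟨u, rfl⟩
    induction u using TensorProduct.induction_on with
    | zero => simp
    | add u v hu hv => rw [map_add]; exact add_mem hu hv
    | tmul ω θ =>
      rw [Submodule.mem_comap, TensorProduct.map_tmul, LinearMap.rTensor_tmul]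
      by_cases hp : p = 0
      · obtain rfl : q = n := by simpa [hp] using hpq
        exact ⟨CA.proj0 ω ⊗ₜ θ, rfl⟩
      · rw [Submodule.subtype_apply, CA.proj0_of_ne hp ω.2, TensorProduct.zero_tmul]
        exact zero_mem _
  exact hle (hDA.2.2.2.2 n x hx)

lemma zeroComponent_sign (x : ΩA) :
    zeroComponent CA DA (CA.sign x) = LinearMap.lTensor A CH.sign (zeroComponent CA DA x) := by
  induction x using CA.homogeneous_induction with
  | add x y hx hy => simp only [map_add, hx, hy]
  | hom n x hx =>
    rw [CA.sign_of_mem hx, lTensor_sign_of_mem CH.toDGA (hDA.zeroComponent_mem hx), map_smul]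

/-- The zero component takes values in the cotensor product of `A` and `Ω(H)`. -/
lemma zeroComponent_coassoc (hL : IsLeftCovariantH CH ΛL) (x : ΩA) :
    TensorProduct.assoc k A H ΩH
        (LinearMap.rTensor ΩH S.ρ.toLinearMap (zeroComponent CA DA x)) =
      LinearMap.lTensor A ΛL (zeroComponent CA DA x) := by
  let F : A ⊗[k] ΩH →ₐ[k] A ⊗[k] (H ⊗[k] ΩH) :=
    (Algebra.TensorProduct.assoc k k k A H ΩH).toAlgHom.comp
      (Algebra.TensorProduct.map S.ρ (AlgHom.id k ΩH))
  let G : A ⊗[k] ΩH →ₐ[k] A ⊗[k] (H ⊗[k] ΩH) :=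
    Algebra.TensorProduct.map (AlgHom.id k A) hL.algHom
  have hFd : ∀ t, F (LinearMap.lTensor A CH.d t) =
      LinearMap.lTensor A (LinearMap.lTensor H CH.d) (F t) := by
    intro t
    induction t using TensorProduct.induction_on with
    | zero => simp
    | add u v hu hv => simp only [map_add, hu, hv]
    | tmul a ω =>
      simp only [LinearMap.lTensor_tmul, F, AlgHom.comp_apply, Algebra.TensorProduct.map_tmul]
      induction S.ρ a using TensorProduct.induction_on with
      | zero => simp
      | add u v hu hv => simp only [map_add, TensorProduct.add_tmul, hu, hv]
      | tmul x y => simp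
  have hGd : ∀ t, G (LinearMap.lTensor A CH.d t) =
      LinearMap.lTensor A (LinearMap.lTensor H CH.d) (G t) := by
    intro t
    change LinearMap.lTensor A ΛL _ = LinearMap.lTensor A _ (LinearMap.lTensor A ΛL t)
    rw [← LinearMap.comp_apply, ← LinearMap.comp_apply, ← LinearMap.lTensor_comp,
      ← LinearMap.lTensor_comp, hL.2.2.2.2.1]
  have hFG : F.toLinearMap ∘ₗ zeroComponent CA DA = G.toLinearMap ∘ₗ zeroComponent CA DA := by
    refine CA.ext_of_mul_of_d (· * ·) (LinearMap.lTensor A (LinearMap.lTensor H CH.d))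
      (fun x y => ?_) (fun x y => ?_) (fun x => ?_) (fun x => ?_) fun a => ?_
    · simp [hDA.zeroComponent_mul]
    · simp [hDA.zeroComponent_mul]
    · simp [hDA.zeroComponent_d, hFd]
    · simp [hDA.zeroComponent_d, hGd]
    · have hρ := S.rTensor_ρ a
      rw [LinearEquiv.eq_symm_apply] at hρ
      have hF : ∀ u : A ⊗[k] H, F (LinearMap.lTensor A CH.ι.toLinearMap u) =
          LinearMap.lTensor A (LinearMap.lTensor H CH.ι.toLinearMap)
            (TensorProduct.assoc k A H H (LinearMap.rTensor H S.ρ.toLinearMap u)) := by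
        intro u
        induction u using TensorProduct.induction_on with
        | zero => simp
        | add u v hu hv => simp only [map_add, hu, hv]
        | tmul b h =>
          simp only [LinearMap.lTensor_tmul, LinearMap.rTensor_tmul, F, AlgHom.comp_apply,
            Algebra.TensorProduct.map_tmul, AlgHom.toLinearMap_apply]
          induction S.ρ b using TensorProduct.induction_on with
          | zero => simp
          | add u v hu hv => simp only [map_add, TensorProduct.add_tmul, hu, hv]
          | tmul x y => simp
      simp only [LinearMap.comp_apply, AlgHom.toLinearMap_apply]
      rw [hDA.zeroComponent_ι, S.coactHom_apply, hF, hρ, ← LinearMap.comp_apply,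
        ← LinearMap.lTensor_comp, ← hL.2.2.2.2.2, LinearMap.lTensor_comp]
      rfl
  exact LinearMap.congr_fun hFG x

lemma twist_verProj (hL : IsLeftCovariantH CH ΛL) (x : ΩA) :
    twist S CH.ι (verProj CA CH ΛL DA x) = zeroComponent CA DA x := by
  rw [← LinearEquiv.eq_symm_apply, twist_symm_apply, coactMul, LinearMap.comp_apply,
    LinearMap.comp_apply, LinearEquiv.coe_coe, hDA.zeroComponent_coassoc hL,
    ← LinearMap.comp_apply, ← LinearMap.lTensor_comp, verProj, LinearMap.comp_apply]
  congr 2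

/-- The twist identifies every vertical projection with the zero component. -/
lemma twist_eq_zeroComponent {πv : ΩA →ₗ[k] A ⊗[k] ΩH} (hι : ∀ a, πv (CA.ι a) = a ⊗ₜ 1)
    (hmul : ∀ x y, πv (x * y) = verMul S CH (πv x ⊗ₜ πv y))
    (hd : πv ∘ₗ CA.d = verD S CH ∘ₗ πv) (x : ΩA) :
    twist S CH.ι (πv x) = zeroComponent CA DA x := by
  have h : (twist S CH.ι).toLinearMap ∘ₗ πv = zeroComponent CA DA := by
    refine CA.ext_of_mul_of_d (· * ·) (LinearMap.lTensor A CH.d) (fun x y => ?_)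
      hDA.zeroComponent_mul (fun x => ?_) hDA.zeroComponent_d fun a => ?_
    · simp [hmul, twist_verMul]
    · have h := LinearMap.congr_fun hd x
      simp only [LinearMap.comp_apply] at h
      simp [h, twist_verD]
    · simp [hι, twist_tmul_one, hDA.zeroComponent_ι]
  exact LinearMap.congr_fun h x

lemma verProj_ι (hL : IsLeftCovariantH CH ΛL) (a : A) :
    verProj CA CH ΛL DA (CA.ι a) = a ⊗ₜ 1 := by
  apply (twist S CH.ι).injective
  rw [hDA.twist_verProj hL, twist_tmul_one, hDA.zeroComponent_ι]

lemma verProj_mul (hL : IsLeftCovariantH CH ΛL) (x y : ΩA) :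
    verProj CA CH ΛL DA (x * y) =
      verMul S CH (verProj CA CH ΛL DA x ⊗ₜ verProj CA CH ΛL DA y) := by
  apply (twist S CH.ι).injective
  rw [twist_verMul, hDA.twist_verProj hL, hDA.twist_verProj hL, hDA.twist_verProj hL,
    hDA.zeroComponent_mul]

lemma verProj_d (hL : IsLeftCovariantH CH ΛL) :
    verProj CA CH ΛL DA ∘ₗ CA.d = verD S CH ∘ₗ verProj CA CH ΛL DA := by
  ext1 x
  apply (twist S CH.ι).injective
  rw [LinearMap.comp_apply, LinearMap.comp_apply, twist_verD, hDA.twist_verProj hL,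
    hDA.twist_verProj hL, hDA.zeroComponent_d]

lemma verProj_mem_verSubN (hL : IsLeftCovariantH CH ΛL) {n : ℕ} {x : ΩA}
    (hx : x ∈ CA.grading n) : verProj CA CH ΛL DA x ∈ verSubN A CH ΛL n :=
  lTensor_mem_range (P := CH.grading n) (Q := leftCoinv ΛL ⊓ CH.grading n)
    (f := piLam CH ΛL)
    (fun _ hω => Submodule.mem_inf.2 ⟨piLam_mem_leftCoinv hL _, piLam_mem_grading hL hω⟩)
    (hDA.zeroComponent_mem hx)

lemma verProj_eq_of_mem {n : ℕ} {x : ΩA} (hx : x ∈ CA.grading n) :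
    verProj CA CH ΛL DA x =
      TensorProduct.map CA.proj0 (piLam CH ΛL ∘ₗ CH.toDGA.projN n) (DA x) := by
  have h : TensorProduct.map CA.proj0 (piLam CH ΛL ∘ₗ CH.toDGA.projN n) =
      LinearMap.lTensor A (piLam CH ΛL) ∘ₗ LinearMap.lTensor A (CH.toDGA.projN n) ∘ₗ
        LinearMap.rTensor ΩH CA.proj0 := by
    ext; simp
  rw [h, LinearMap.comp_apply, LinearMap.comp_apply]
  change _ = LinearMap.lTensor A _ (LinearMap.lTensor A _ (zeroComponent CA DA x))
  rw [lTensor_projN_of_mem CH.toDGA (hDA.zeroComponent_mem hx)]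
  rfl

/-- If the canonical map of the extension is surjective, then `A ⊗ Ω(H)` is generated as a left
`A`-module by the zero components of forms. -/
lemma mem_span_mul_zeroComponent (hχ : Function.Surjective (chiAux S)) (t : A ⊗[k] ΩH) :
    t ∈ Submodule.span k
      {z | ∃ (a : A) (x : ΩA), z = (a ⊗ₜ[k] (1 : ΩH)) * zeroComponent CA DA x} := by
  set P := Submodule.span k
    {z | ∃ (a : A) (x : ΩA), z = (a ⊗ₜ[k] (1 : ΩH)) * zeroComponent CA DA x}
  have hP : ∀ a x, (a ⊗ₜ[k] (1 : ΩH)) * zeroComponent CA DA x ∈ P :=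
    fun a x => Submodule.subset_span ⟨a, x, rfl⟩
  have hχP : ∀ u, LinearMap.lTensor A CH.ι.toLinearMap (chiAux S u) ∈ P := by
    intro u
    induction u using TensorProduct.induction_on with
    | zero => simp
    | add u v hu hv => simpa only [map_add] using add_mem hu hv
    | tmul a b =>
      convert hP a (CA.ι b)
      rw [hDA.zeroComponent_ι]
      change Algebra.TensorProduct.map (AlgHom.id k A) CH.ι ((a ⊗ₜ 1) * S.ρ b) = _
      simp [ComodAlg.coactHom]
  have hPd : ∀ z ∈ P, LinearMap.lTensor A CH.d z ∈ P := by
    intro z hz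
    induction hz using Submodule.span_induction with
    | zero => simp
    | add u v _ _ hu hv => rw [map_add]; exact add_mem hu hv
    | smul c u _ hu => rw [map_smul]; exact Submodule.smul_mem _ c hu
    | mem z hz =>
      obtain ⟨a, x, rfl⟩ := hz
      rw [lTensor_tmul_one_mul, ← hDA.zeroComponent_d]
      exact hP a _
  have hPmul : ∀ x, ∀ z ∈ P, z * zeroComponent CA DA x ∈ P := by
    intro x z hz
    induction hz using Submodule.span_induction with
    | zero => simp
    | add u v _ _ hu hv => rw [add_mul]; exact add_mem hu hv
    | smul c u _ hu => rw [smul_mul_assoc]; exact Submodule.smul_mem _ c hu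
    | mem z hz =>
      obtain ⟨a, y, rfl⟩ := hz
      rw [mul_assoc, ← hDA.zeroComponent_mul]
      exact hP a _
  have hω : ∀ ω : ΩH, ∀ a : A, a ⊗ₜ ω ∈ P := by
    intro ω
    induction ω using CH.induction with
    | ι h =>
      intro a
      obtain ⟨u, hu⟩ := hχ (a ⊗ₜ h)
      simpa [hu] using hχP u
    | add ω η hω hη => intro a; rw [TensorProduct.tmul_add]; exact add_mem (hω a) (hη a)
    | d ω hω => intro a; simpa using hPd _ (hω a)
    | mul ω η hω hη =>
      intro a
      have key : ∀ z ∈ P, (a ⊗ₜ ω) * z ∈ P := by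
        intro z hz
        induction hz using Submodule.span_induction with
        | zero => simp
        | add u v _ _ hu hv => rw [mul_add]; exact add_mem hu hv
        | smul c u _ hu => rw [mul_smul_comm]; exact Submodule.smul_mem _ c hu
        | mem z hz =>
          obtain ⟨b, x, rfl⟩ := hz
          rw [← mul_assoc, Algebra.TensorProduct.tmul_mul_tmul, mul_one]
          exact hPmul x _ (hω _)
      simpa using key _ (hη 1)
  induction t using TensorProduct.induction_on with
  | zero => exact zero_mem _
  | add u v hu hv => exact add_mem hu hv
  | tmul a ω => exact hω ω a

lemma exists_verProj_eq (hχ : Function.Surjective (chiAux S)) (hL : IsLeftCovariantH CH ΛL)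
    {t : A ⊗[k] ΩH} (ht : t ∈ verSub A ΛL) : ∃ x, verProj CA CH ΛL DA x = t := by
  have hfix : LinearMap.lTensor A (piLam CH ΛL) t = t := by
    obtain ⟨u, rfl⟩ := ht
    induction u using TensorProduct.induction_on with
    | zero => simp
    | add u v hu hv => simp only [map_add, hu, hv]
    | tmul a ϑ => simp [piLam_of_mem_leftCoinv ϑ.2]
  rw [← hfix, ← LinearMap.mem_range]
  clear ht hfix
  induction hDA.mem_span_mul_zeroComponent hχ t using Submodule.span_induction with
  | zero => simp
  | add u v _ _ hu hv => rw [map_add]; exact add_mem hu hv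
  | smul c u _ hu => rw [map_smul]; exact Submodule.smul_mem _ c hu
  | mem z hz =>
    obtain ⟨a, x, rfl⟩ := hz
    refine ⟨CA.ι a * x, ?_⟩
    rw [hDA.verProj_mul hL, hDA.verProj_ι hL, verMul_tmul_one, lTensor_tmul_one_mul]
    rfl

end IsCompleteExt

lemma rTensor_twist_verCoact (t : A ⊗[k] ΩH) :
    LinearMap.rTensor ΩH (twist S CH.ι).toLinearMap (verCoact S CH DH t) =
      (TensorProduct.assoc k A ΩH ΩH).symm (LinearMap.lTensor A DH (twist S CH.ι t)) := by
  simp only [verCoact, LinearMap.comp_apply]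
  rw [← LinearMap.comp_apply, ← LinearMap.rTensor_comp]
  simp

lemma rTensor_twist_injective :
    Function.Injective (LinearMap.rTensor ΩH (twist S CH.ι).toLinearMap) :=
  ((twist S CH.ι).rTensor ΩH).injective

variable (hDH : IsCompleteExtH CH DH)
include hDH

lemma IsCompleteExtH.coassoc_ρ (a : A) :
    (TensorProduct.assoc k A ΩH ΩH).symm (LinearMap.lTensor A DH (S.coactHom CH.ι a)) =
      TensorProduct.map (S.coactHom CH.ι).toLinearMap CH.ι.toLinearMap (S.ρ a) := by
  have hι : DH ∘ₗ CH.ι.toLinearMap =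
      TensorProduct.map CH.ι.toLinearMap CH.ι.toLinearMap ∘ₗ Coalgebra.comul := hDH.2.2.1
  have hρ := S.rTensor_ρ a
  rw [LinearEquiv.eq_symm_apply] at hρ
  rw [S.coactHom_apply, ← LinearMap.comp_apply, ← LinearMap.lTensor_comp, hι,
    LinearMap.lTensor_comp, LinearMap.comp_apply, ← hρ]
  induction S.ρ a using TensorProduct.induction_on with
  | zero => simp
  | add u v hu hv => simp only [map_add, hu, hv]
  | tmul b h =>
    simp only [LinearMap.rTensor_tmul, TensorProduct.map_tmul, AlgHom.toLinearMap_apply,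
      S.coactHom_apply]
    induction S.ρ b using TensorProduct.induction_on with
    | zero => simp
    | add u v hu hv => simp only [map_add, TensorProduct.add_tmul, hu, hv]
    | tmul x y => simp

lemma IsCompleteExtH.lTensor_mul (s t : A ⊗[k] ΩH) :
    (TensorProduct.assoc k A ΩH ΩH).symm (LinearMap.lTensor A DH (s * t)) =
      koszulMulGen (LinearMap.mul' k (A ⊗[k] ΩH)) (LinearMap.mul' k ΩH) CH.toDGA
        (LinearMap.lTensor A CH.sign)
        ((TensorProduct.assoc k A ΩH ΩH).symm (LinearMap.lTensor A DH s) ⊗ₜ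
          (TensorProduct.assoc k A ΩH ΩH).symm (LinearMap.lTensor A DH t)) := by
  induction s using TensorProduct.induction_on with
  | zero => simp
  | add u v hu hv => simp only [map_add, add_mul, TensorProduct.add_tmul, hu, hv]
  | tmul a ω =>
  induction t using TensorProduct.induction_on with
  | zero => simp
  | add u v hu hv => simp only [map_add, mul_add, TensorProduct.tmul_add, hu, hv]
  | tmul b η =>
    rw [Algebra.TensorProduct.tmul_mul_tmul, LinearMap.lTensor_tmul, LinearMap.lTensor_tmul,
      LinearMap.lTensor_tmul, IsCompleteExt.map_mul hDH, assoc_symm_koszulMul]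

lemma IsCompleteExtH.lTensor_d (t : A ⊗[k] ΩH) :
    (TensorProduct.assoc k A ΩH ΩH).symm (LinearMap.lTensor A DH (LinearMap.lTensor A CH.d t)) =
      dTensorGen (LinearMap.lTensor A CH.d) (LinearMap.lTensor A CH.sign) CH.d
        ((TensorProduct.assoc k A ΩH ΩH).symm (LinearMap.lTensor A DH t)) := by
  have hd : DH ∘ₗ CH.d = dTensorGen CH.d CH.sign CH.d ∘ₗ DH := hDH.2.2.2.1
  rw [← LinearMap.comp_apply (LinearMap.lTensor A DH), ← LinearMap.lTensor_comp, hd,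
    LinearMap.lTensor_comp, LinearMap.comp_apply, assoc_symm_dTensorGen]

lemma IsCompleteExtH.verCoact_verMul (s t : A ⊗[k] ΩH) :
    verCoact S CH DH (verMul S CH (s ⊗ₜ t)) =
      koszulMulGen (verMul S CH) (LinearMap.mul' k ΩH) CH.toDGA (LinearMap.lTensor A CH.sign)
        (verCoact S CH DH s ⊗ₜ verCoact S CH DH t) := by
  apply rTensor_twist_injective (S := S) (CH := CH)
  rw [rTensor_koszulMulGen (mulM' := LinearMap.mul' k (A ⊗[k] ΩH))
      (s' := LinearMap.lTensor A CH.sign) _ _ _ (fun x y => by simp [twist_verMul])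
      (twist_lTensor_sign S CH),
    rTensor_twist_verCoact, rTensor_twist_verCoact, rTensor_twist_verCoact, twist_verMul,
    hDH.lTensor_mul]

lemma IsCompleteExtH.verCoact_verD :
    verCoact S CH DH ∘ₗ verD S CH =
      dTensorGen (verD S CH) (LinearMap.lTensor A CH.sign) CH.d ∘ₗ verCoact S CH DH := by
  refine LinearMap.ext fun t => ?_
  apply rTensor_twist_injective (S := S) (CH := CH)
  rw [LinearMap.comp_apply, LinearMap.comp_apply,
    rTensor_dTensorGen (d' := LinearMap.lTensor A CH.d) (s' := LinearMap.lTensor A CH.sign) _ _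
      (twist_verD S CH) (twist_lTensor_sign S CH),
    rTensor_twist_verCoact, rTensor_twist_verCoact, twist_verD, hDH.lTensor_d]

lemma IsCompleteExtH.verCoact_tmul_one (a : A) :
    verCoact S CH DH (a ⊗ₜ 1) =
      TensorProduct.map ((TensorProduct.mk k A ΩH).flip 1) CH.ι.toLinearMap (S.ρ a) := by
  apply rTensor_twist_injective (S := S) (CH := CH)
  rw [rTensor_twist_verCoact, twist_tmul_one, hDH.coassoc_ρ, LinearMap.rTensor,
    TensorProduct.map_map, LinearMap.id_comp]
  congr 2
  ext b
  exact (twist_tmul_one S CH.ι b).symm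

lemma IsCompleteExt.rTensor_zeroComponent (hDA : IsCompleteExt S CA CH DA) (x : ΩA) :
    LinearMap.rTensor ΩH (zeroComponent CA DA) (DA x) =
      (TensorProduct.assoc k A ΩH ΩH).symm (LinearMap.lTensor A DH (zeroComponent CA DA x)) := by
  have h : LinearMap.rTensor ΩH (zeroComponent CA DA) ∘ₗ DA =
      (TensorProduct.assoc k A ΩH ΩH).symm.toLinearMap ∘ₗ LinearMap.lTensor A DH ∘ₗ
        zeroComponent CA DA := by
    refine CA.ext_of_mul_of_d
      (fun u v => koszulMulGen (LinearMap.mul' k (A ⊗[k] ΩH)) (LinearMap.mul' k ΩH) CH.toDGA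
        (LinearMap.lTensor A CH.sign) (u ⊗ₜ v))
      (dTensorGen (LinearMap.lTensor A CH.d) (LinearMap.lTensor A CH.sign) CH.d)
      (fun x y => ?_) (fun x y => ?_) (fun x => ?_) (fun x => ?_) fun a => ?_
    · simp only [LinearMap.comp_apply]
      rw [hDA.map_mul, koszulMul]
      exact rTensor_koszulMulGen _ _ _ (fun x y => by simp [hDA.zeroComponent_mul])
        hDA.zeroComponent_sign _ _
    · simp only [LinearMap.comp_apply, LinearEquiv.coe_coe]
      rw [hDA.zeroComponent_mul, hDH.lTensor_mul]
    · simp only [LinearMap.comp_apply]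
      rw [hDA.map_d]
      exact rTensor_dTensorGen _ _ hDA.zeroComponent_d hDA.zeroComponent_sign _
    · simp only [LinearMap.comp_apply, LinearEquiv.coe_coe]
      rw [hDA.zeroComponent_d, hDH.lTensor_d]
    · simp only [LinearMap.comp_apply, LinearEquiv.coe_coe]
      rw [hDA.map_ι, hDA.zeroComponent_ι, hDH.coassoc_ρ, LinearMap.rTensor,
        TensorProduct.map_map, LinearMap.id_comp]
      congr 2
      ext b
      exact hDA.zeroComponent_ι b
  exact LinearMap.congr_fun h x

lemma IsCompleteExt.verCoact_comp (hDA : IsCompleteExt S CA CH DA) {πv : ΩA →ₗ[k] A ⊗[k] ΩH}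
    (hπ : ∀ x, twist S CH.ι (πv x) = zeroComponent CA DA x) :
    verCoact S CH DH ∘ₗ πv = LinearMap.rTensor ΩH πv ∘ₗ DA := by
  refine LinearMap.ext fun x => ?_
  apply rTensor_twist_injective (S := S) (CH := CH)
  have hπ' : (twist S CH.ι).toLinearMap ∘ₗ πv = zeroComponent CA DA := LinearMap.ext hπ
  rw [LinearMap.comp_apply, LinearMap.comp_apply, rTensor_twist_verCoact, hπ,
    ← LinearMap.comp_apply (LinearMap.rTensor ΩH _), ← LinearMap.rTensor_comp, hπ',
    hDA.rTensor_zeroComponent hDH]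

end VerticalProjection

end NCG
namespace NCG

/-- For a complete calculus `Ω•(A)` on a quantum principal
bundle: (i) there is a unique surjective morphism of DGAs
`π_v : Ω•(A) → ver•` extending `id_A`, determined in degree `k` by
`π_v = (id ⊗ (π_Λ ∘ π^k)) ∘ Δ_A•`; (ii) the vertical forms are complete:
there is a morphism of DGAs `Δ_v• : ver• → ver• ⊗ Ω•(H)` extending the
coaction with `Δ_v• ∘ π_v = (π_v ⊗ id) ∘ Δ_A•`. -/
theorem vertical_projection_and_completeness_of_ver
    {k : Type*} [Field k] {H : Type*} [Ring H] [HopfAlgebra k H]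
    (hS : Function.Bijective (HopfAlgebra.antipode (R := k) (A := H)))
    {A : Type*} [Ring A] [Algebra k A] (S : ComodAlg k H A) (hQPB : S.IsQPB)
    {ΩH : Type*} [Ring ΩH] [Algebra k ΩH] (CH : DiffCalc k H ΩH)
    (ΔR : ΩH →ₗ[k] ΩH ⊗[k] H) (ΛL : ΩH →ₗ[k] H ⊗[k] ΩH)
    (hbicov : IsBicovariantH CH ΔR ΛL) (hmax : IsMaxProl (k := k) CH)
    (DH : ΩH →ₗ[k] ΩH ⊗[k] ΩH) (hDH : IsCompleteExtH CH DH)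
    {ΩA : Type*} [Ring ΩA] [Algebra k ΩA] (CA : DiffCalc k A ΩA)
    (DA : ΩA →ₗ[k] ΩA ⊗[k] ΩH) (hDA : IsCompleteExt S CA CH DA) :
    -- (i) existence and uniqueness of the vertical projection
    (∃! πv : ΩA →ₗ[k] A ⊗[k] ΩH,
      (∀ a : A, πv (CA.ι a) = a ⊗ₜ[k] (1 : ΩH)) ∧
      (∀ x y, πv (x * y) = verMul S CH (πv x ⊗ₜ[k] πv y)) ∧
      (πv ∘ₗ CA.d = verD S CH ∘ₗ πv) ∧
      (∀ x, πv x ∈ verSub A ΛL) ∧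
      (∀ n : ℕ, ∀ x ∈ CA.grading n, πv x ∈ verSubN A CH ΛL n) ∧
      (∀ t ∈ verSub A ΛL, ∃ x, πv x = t) ∧
      (∀ K : ℕ, ∀ x ∈ CA.grading K,
        πv x =
          TensorProduct.map CA.proj0 (piLam CH ΛL ∘ₗ CH.toDGA.projN K) (DA x))) ∧
    -- (ii) the vertical forms are complete and the diagram commutes
    (∀ πv : ΩA →ₗ[k] A ⊗[k] ΩH,
      (∀ a : A, πv (CA.ι a) = a ⊗ₜ[k] (1 : ΩH)) →
      (∀ x y, πv (x * y) = verMul S CH (πv x ⊗ₜ[k] πv y)) →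
      (πv ∘ₗ CA.d = verD S CH ∘ₗ πv) →
      (∀ x, πv x ∈ verSub A ΛL) →
      ∃ Dv : A ⊗[k] ΩH →ₗ[k] (A ⊗[k] ΩH) ⊗[k] ΩH,
        Dv ∘ₗ πv = LinearMap.rTensor ΩH πv ∘ₗ DA ∧
        Dv ∘ₗ (TensorProduct.mk k A ΩH).flip 1 =
          TensorProduct.map ((TensorProduct.mk k A ΩH).flip 1)
            CH.ι.toLinearMap ∘ₗ S.ρ.toLinearMap ∧
        (∀ s ∈ verSub A ΛL, ∀ t ∈ verSub A ΛL,
          Dv (verMul S CH (s ⊗ₜ[k] t)) =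
            koszulMulGen (verMul S CH) (LinearMap.mul' k ΩH) CH.toDGA
              (LinearMap.lTensor A CH.toDGA.sign) (Dv s ⊗ₜ[k] Dv t)) ∧
        Dv ∘ₗ verD S CH =
          dTensorGen (verD S CH) (LinearMap.lTensor A CH.toDGA.sign) CH.d ∘ₗ Dv) := by
  have hL := hbicov.2.1
  refine ⟨⟨verProj CA CH ΛL DA, ⟨hDA.verProj_ι hL, hDA.verProj_mul hL, hDA.verProj_d hL, ?_,
    fun n x hx => hDA.verProj_mem_verSubN hL hx,
    fun t ht => hDA.exists_verProj_eq hQPB.1.1 hL ht,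
    fun n x hx => hDA.verProj_eq_of_mem hx⟩, ?_⟩, ?_⟩
  · intro x
    exact lTensor_mem_range (P := ⊤) (fun ω _ => piLam_mem_leftCoinv hL ω)
      (LinearMap.lTensor_surjective A (fun ω => ⟨⟨ω, trivial⟩, rfl⟩) _)
  · rintro πv ⟨hι, hmul, hd, -⟩
    ext1 x
    apply (twist S CH.ι).injective
    rw [hDA.twist_eq_zeroComponent hι hmul hd, hDA.twist_verProj hL]
  · intro πv hι hmul hd _
    refine ⟨verCoact S CH DH, hDA.verCoact_comp hDH (hDA.twist_eq_zeroComponent hι hmul hd),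
      LinearMap.ext hDH.verCoact_tmul_one, fun s _ t _ => hDH.verCoact_verMul s t,
      hDH.verCoact_verD⟩

end NCG
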